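/- arXiv:2209.15531 — 4 statements merged into one kernel-verified Lean document; each statement's English description precedes it below -/
import Mathlib

section
/- Let (V, ω) be a real symplectic vector space of dimension 2n with n ≥ 3, and let 0 < k < n. Then the linear map L : Λ²V* → Λ^{2k}V* defined by α ↦ ω^{k-1} ∧ α is injective. -/
noncomputable section

open ExteriorAlgebra

/-- The value of an exterior 2-form (an element of the exterior algebra of the dual space)
on a pair of vectors, obtained by contracting twice. -/
def formEval {V : Type*} [AddCommGroup V] [Module ℝ V]
    (x : ExteriorAlgebra ℝ (Module.Dual ℝ V)) (u v : V) : ℝ :=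
  algebraMapInv
    (CliffordAlgebra.contractLeft (Module.Dual.eval ℝ V v)
      (CliffordAlgebra.contractLeft (Module.Dual.eval ℝ V u) x))

section helpers
variable {V : Type*} [AddCommGroup V] [Module ℝ V]

/-- Contraction with a vector. -/
def ctr (u : V) : ExteriorAlgebra ℝ (Module.Dual ℝ V) →ₗ[ℝ] ExteriorAlgebra ℝ (Module.Dual ℝ V) :=
  CliffordAlgebra.contractLeft (Module.Dual.eval ℝ V u)

theorem ctr_one (u : V) : ctr u 1 = 0 := CliffordAlgebra.contractLeft_one _ _

theorem ctr_ι (u : V) (θ : Module.Dual ℝ V) :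
    ctr u (ExteriorAlgebra.ι ℝ θ) = algebraMap ℝ _ (θ u) :=
  CliffordAlgebra.contractLeft_ι _ _ _

theorem ctr_ι_mul (u : V) (θ : Module.Dual ℝ V) (y : ExteriorAlgebra ℝ (Module.Dual ℝ V)) :
    ctr u (ExteriorAlgebra.ι ℝ θ * y) = θ u • y - ExteriorAlgebra.ι ℝ θ * ctr u y :=
  CliffordAlgebra.contractLeft_ι_mul _ _ _

theorem ι_anticomm (a b : Module.Dual ℝ V) :
    ExteriorAlgebra.ι ℝ a * ExteriorAlgebra.ι ℝ b
      = - (ExteriorAlgebra.ι ℝ b * ExteriorAlgebra.ι ℝ a) :=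
  eq_neg_of_add_eq_zero_left (ExteriorAlgebra.ι_add_mul_swap a b)

/-- Induction on the degree of a form. -/
theorem pow_succ_ind (p : ℕ) {P : ExteriorAlgebra ℝ (Module.Dual ℝ V) → Prop}
    (hm : ∀ (θ : Module.Dual ℝ V) (y), y ∈ ⋀[ℝ]^p (Module.Dual ℝ V) →
      P (ExteriorAlgebra.ι ℝ θ * y))
    (ha : ∀ x y, P x → P y → P (x + y))
    {x} (hx : x ∈ ⋀[ℝ]^(p+1) (Module.Dual ℝ V)) : P x := by
  rw [exteriorPower, pow_succ'] at hx
  refine Submodule.mul_induction_on hx ?_ ha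
  rintro _ ⟨θ, rfl⟩ y hy
  exact hm θ y hy

theorem mul_mem' (p : ℕ) (θ : Module.Dual ℝ V) {y} (hy : y ∈ ⋀[ℝ]^p (Module.Dual ℝ V)) :
    ExteriorAlgebra.ι ℝ θ * y ∈ ⋀[ℝ]^(p+1) (Module.Dual ℝ V) := by
  rw [exteriorPower, pow_succ']
  exact Submodule.mul_mem_mul ⟨θ, rfl⟩ hy

theorem ctr_zero (u : V) {x} (hx : x ∈ ⋀[ℝ]^0 (Module.Dual ℝ V)) : ctr u x = 0 := by
  rw [exteriorPower, pow_zero, Submodule.mem_one] at hx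
  obtain ⟨c, rfl⟩ := hx
  rw [Algebra.algebraMap_eq_smul_one, map_smul, ctr_one, smul_zero]

theorem ctr_mem (u : V) (p : ℕ) : ∀ {x}, x ∈ ⋀[ℝ]^(p+1) (Module.Dual ℝ V) →
    ctr u x ∈ ⋀[ℝ]^p (Module.Dual ℝ V) := by
  induction p with
  | zero =>
    intro x hx
    refine pow_succ_ind 0 (P := fun x => ctr u x ∈ ⋀[ℝ]^0 (Module.Dual ℝ V)) ?_ ?_ hx
    · intro θ y hy
      rw [ctr_ι_mul, ctr_zero u hy, mul_zero, sub_zero]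
      exact Submodule.smul_mem _ _ hy
    · intro x y h1 h2
      rw [map_add]; exact Submodule.add_mem _ h1 h2
  | succ p ih =>
    intro x hx
    refine pow_succ_ind (p+1) (P := fun x => ctr u x ∈ ⋀[ℝ]^(p+1) (Module.Dual ℝ V)) ?_ ?_ hx
    · intro θ y hy
      rw [ctr_ι_mul]
      exact Submodule.sub_mem _ (Submodule.smul_mem _ _ hy) (mul_mem' p θ (ih hy))
    · intro x y h1 h2
      rw [map_add]; exact Submodule.add_mem _ h1 h2

theorem two_ind {P : ExteriorAlgebra ℝ (Module.Dual ℝ V) → Prop}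
    (hm : ∀ a b : Module.Dual ℝ V, P (ExteriorAlgebra.ι ℝ a * ExteriorAlgebra.ι ℝ b))
    (ha : ∀ x y, P x → P y → P (x + y))
    {x} (hx : x ∈ ⋀[ℝ]^2 (Module.Dual ℝ V)) : P x := by
  rw [exteriorPower, pow_two] at hx
  refine Submodule.mul_induction_on hx ?_ ha
  rintro _ ⟨a, rfl⟩ _ ⟨b, rfl⟩
  exact hm a b

theorem ctr_two_mul (u : V) {ω} (hω : ω ∈ ⋀[ℝ]^2 (Module.Dual ℝ V)) (x) :
    ctr u (ω * x) = ctr u ω * x + ω * ctr u x := by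
  refine two_ind (P := fun ω => ctr u (ω * x) = ctr u ω * x + ω * ctr u x) ?_ ?_ hω
  · intro a b
    rw [mul_assoc, ctr_ι_mul, ctr_ι_mul, ctr_ι_mul, ctr_ι, Algebra.algebraMap_eq_smul_one]
    simp only [mul_sub, sub_mul, mul_smul_comm, smul_mul_assoc, mul_one, mul_assoc]
    abel
  · intro x y h1 h2
    simp only [add_mul, map_add, h1, h2]; abel

theorem two_comm {ω} (hω : ω ∈ ⋀[ℝ]^2 (Module.Dual ℝ V)) (θ : Module.Dual ℝ V) :
    ω * ExteriorAlgebra.ι ℝ θ = ExteriorAlgebra.ι ℝ θ * ω := by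
  refine two_ind (P := fun ω => ω * ExteriorAlgebra.ι ℝ θ = ExteriorAlgebra.ι ℝ θ * ω) ?_ ?_ hω
  · intro a b
    rw [mul_assoc, ι_anticomm b θ, mul_neg, ← mul_assoc, ι_anticomm a θ, neg_mul, neg_neg,
      mul_assoc]
  · intro x y h1 h2
    simp only [add_mul, mul_add, h1, h2]

theorem ctr_two {ω} (hω : ω ∈ ⋀[ℝ]^2 (Module.Dual ℝ V)) (u : V) :
    ∃ θ : Module.Dual ℝ V, ctr u ω = ExteriorAlgebra.ι ℝ θ ∧ ∀ v, formEval ω u v = θ v := by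
  have h := ctr_mem u 1 hω
  rw [exteriorPower, pow_one] at h
  obtain ⟨θ, h⟩ := h
  refine ⟨θ, h.symm, fun v => ?_⟩
  have : formEval ω u v = algebraMapInv (ctr v (ctr u ω)) := rfl
  rw [this, ← h, ctr_ι]
  exact ExteriorAlgebra.algebraMap_leftInverse _ _

theorem ctr_pow (u : V) {ω} (hω : ω ∈ ⋀[ℝ]^2 (Module.Dual ℝ V)) (m : ℕ) (x) :
    ctr u (ω ^ (m+1) * x) = (m+1) • (ctr u ω * (ω ^ m * x)) + ω ^ (m+1) * ctr u x := by
  induction m with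
  | zero => simp [ctr_two_mul u hω]
  | succ m ih =>
    rw [pow_succ' ω (m+1), mul_assoc, ctr_two_mul u hω, ih]
    obtain ⟨θ, h, -⟩ := ctr_two hω u
    rw [h, mul_add, mul_smul_comm, ← mul_assoc ω, two_comm hω, mul_assoc _ ω, ← mul_assoc ω (ω^m),
      ← pow_succ', succ_nsmul _ (m+1), mul_assoc]
    abel

variable {ι' : Type*} [Fintype ι']

theorem euler (b : Module.Basis ι' ℝ V) (p : ℕ) : ∀ {x}, x ∈ ⋀[ℝ]^p (Module.Dual ℝ V) →
    ∑ i, ExteriorAlgebra.ι ℝ (b.coord i) * ctr (b i) x = (p : ℝ) • x := by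
  induction p with
  | zero => intro x hx; simp [ctr_zero _ hx]
  | succ p ih =>
    intro x hx
    refine pow_succ_ind p (P := fun x => ∑ i, ExteriorAlgebra.ι ℝ (b.coord i) * ctr (b i) x
      = ((p+1 : ℕ) : ℝ) • x) ?_ ?_ hx
    · intro θ y hy
      have h1 : ∑ i, θ (b i) • b.coord i = θ := by
        classical
        refine b.ext fun j => ?_
        simp [Finsupp.single_apply]
      have h2 : ∀ i, ExteriorAlgebra.ι ℝ (b.coord i) * ctr (b i) (ExteriorAlgebra.ι ℝ θ * y)
          = ExteriorAlgebra.ι ℝ (θ (b i) • b.coord i) * y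
            + ExteriorAlgebra.ι ℝ θ * (ExteriorAlgebra.ι ℝ (b.coord i) * ctr (b i) y) := by
        intro i
        rw [ctr_ι_mul, mul_sub, ← mul_assoc, ι_anticomm, map_smul, mul_smul_comm, smul_mul_assoc,
          neg_mul, sub_neg_eq_add, mul_assoc]
      simp only [h2]
      rw [Finset.sum_add_distrib, ← Finset.sum_mul, ← map_sum, h1, ← Finset.mul_sum, ih hy,
        mul_smul_comm]
      push_cast
      rw [add_smul, one_smul, add_comm]
    · intro x y h1 h2
      simp only [map_add, mul_add, Finset.sum_add_distrib, h1, h2, smul_add]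

theorem eq_zero_of_ctr [FiniteDimensional ℝ V] (p : ℕ) {x}
    (hx : x ∈ ⋀[ℝ]^(p+1) (Module.Dual ℝ V)) (h : ∀ u : V, ctr u x = 0) : x = 0 := by
  have := euler (Module.finBasis ℝ V) (p+1) hx
  simp only [h, mul_zero, Finset.sum_const_zero] at this
  exact (smul_eq_zero.1 this.symm).resolve_left (by positivity)

theorem eq_zero_of_mul [FiniteDimensional ℝ V] (p : ℕ) {x}
    (hx : x ∈ ⋀[ℝ]^p (Module.Dual ℝ V)) (hp : p < Module.finrank ℝ V)
    (h : ∀ θ : Module.Dual ℝ V, ExteriorAlgebra.ι ℝ θ * x = 0) : x = 0 := by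
  have he := euler (Module.finBasis ℝ V) p hx
  have h2 : ∀ i, ExteriorAlgebra.ι ℝ ((Module.finBasis ℝ V).coord i)
      * ctr (Module.finBasis ℝ V i) x = x := by
    intro i
    have := ctr_ι_mul (Module.finBasis ℝ V i) ((Module.finBasis ℝ V).coord i) x
    rw [h, map_zero] at this
    have := sub_eq_zero.1 this.symm
    rw [← this]; simp
  simp only [h2, Finset.sum_const, Finset.card_univ, Fintype.card_fin] at he
  rw [← Nat.cast_smul_eq_nsmul ℝ, ← sub_eq_zero, ← sub_smul] at he
  refine (smul_eq_zero.1 he).resolve_left (sub_ne_zero.2 ?_)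
  exact_mod_cast hp.ne'

theorem surj [FiniteDimensional ℝ V] {ω} (hω : ω ∈ ⋀[ℝ]^2 (Module.Dual ℝ V))
    (hnd : ∀ u : V, (∀ v : V, formEval ω u v = 0) → u = 0) (θ : Module.Dual ℝ V) :
    ∃ u : V, ctr u ω = ExteriorAlgebra.ι ℝ θ := by
  choose B hB hB' using ctr_two hω
  let L : V →ₗ[ℝ] Module.Dual ℝ V :=
    { toFun := B
      map_add' := fun u v => by
        apply (ExteriorAlgebra.ι_leftInverse (R := ℝ) (M := Module.Dual ℝ V)).injective
        rw [map_add, ← hB, ← hB, ← hB]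
        simp [ctr]
      map_smul' := fun c v => by
        apply (ExteriorAlgebra.ι_leftInverse (R := ℝ) (M := Module.Dual ℝ V)).injective
        rw [RingHom.id_apply, map_smul, ← hB, ← hB]
        simp [ctr] }
  have hi : Function.Injective L := by
    rw [injective_iff_map_eq_zero]
    intro u hu
    refine hnd u fun v => ?_
    rw [hB']
    exact LinearMap.congr_fun hu v
  obtain ⟨u, hu⟩ := (LinearMap.injective_iff_surjective_of_finrank_eq_finrank
    (Subspace.dual_finrank_eq (K := ℝ) (V := V)).symm).1 hi θ
  exact ⟨u, by rw [hB, ← hu]; rfl⟩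

theorem pow_ne [FiniteDimensional ℝ V] {ω} (hω : ω ∈ ⋀[ℝ]^2 (Module.Dual ℝ V))
    (hnd : ∀ u : V, (∀ v : V, formEval ω u v = 0) → u = 0) (m : ℕ) :
    2 * m ≤ Module.finrank ℝ V → ω ^ m ≠ 0 := by
  induction m with
  | zero => intro _; simp
  | succ m ih =>
    intro hm h0
    apply ih (by omega)
    have hmem : ω ^ m ∈ ⋀[ℝ]^(2*m) (Module.Dual ℝ V) := by
      rw [exteriorPower, pow_mul]
      exact Submodule.pow_mem_pow _ hω m
    refine eq_zero_of_mul (2*m) hmem (by omega) fun θ => ?_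
    obtain ⟨u, hu⟩ := surj hω hnd θ
    have := ctr_pow u hω m 1
    rw [h0, zero_mul, zero_mul, map_zero, add_zero, mul_one, hu] at this
    rw [← Nat.cast_smul_eq_nsmul ℝ] at this
    exact (smul_eq_zero.1 this.symm).resolve_left (by positivity)

theorem lefschetz [FiniteDimensional ℝ V] {ω} (hω : ω ∈ ⋀[ℝ]^2 (Module.Dual ℝ V))
    (hnd : ∀ u : V, (∀ v : V, formEval ω u v = 0) → u = 0) (p : ℕ) :
    ∀ (m : ℕ), 2 * (m + p) ≤ Module.finrank ℝ V →
    ∀ x ∈ ⋀[ℝ]^p (Module.Dual ℝ V), ω ^ m * x = 0 → x = 0 := by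
  induction p with
  | zero =>
    intro m hm x hx h
    rw [exteriorPower, pow_zero, Submodule.mem_one] at hx
    obtain ⟨c, rfl⟩ := hx
    rw [Algebra.algebraMap_eq_smul_one, mul_smul_comm, mul_one] at h
    rw [(smul_eq_zero.1 h).resolve_right (pow_ne hω hnd m (by omega)), map_zero]
  | succ p ih =>
    intro m hm x hx h
    refine eq_zero_of_ctr p hx fun u => ih (m+1) (by omega) _ (ctr_mem u p hx) ?_
    have := ctr_pow u hω m x
    rw [h, pow_succ', mul_assoc, h] at this
    simpa [pow_succ'] using this.symm

end helpers

theorem stmt0 {V : Type*} [AddCommGroup V] [Module ℝ V] [FiniteDimensional ℝ V]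
    (n k : ℕ) (hn : 3 ≤ n) (hdim : Module.finrank ℝ V = 2 * n)
    (hk0 : 0 < k) (hkn : k < n)
    (ω : ExteriorAlgebra ℝ (Module.Dual ℝ V))
    (hω2 : ω ∈ ⋀[ℝ]^2 (Module.Dual ℝ V))
    (hnd : ∀ u : V, (∀ v : V, formEval ω u v = 0) → u = 0) :
    Function.Injective fun α : ⋀[ℝ]^2 (Module.Dual ℝ V) =>
      ω ^ (k - 1) * (α : ExteriorAlgebra ℝ (Module.Dual ℝ V)) := by
  intro α β h
  have h' : ω ^ (k - 1) * ((α : ExteriorAlgebra ℝ (Module.Dual ℝ V)) - β) = 0 := by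
    rw [mul_sub]; exact sub_eq_zero.2 h
  exact Subtype.ext (sub_eq_zero.1 (lefschetz hω2 hnd 2 (k-1) (by omega) _
    (Submodule.sub_mem _ α.2 β.2) h'))
end
end

section
/- Let (V, ω) be a 2n-dimensional real symplectic vector space and let α be a nondegenerate alternating bilinear form on V that is not a real scalar multiple of ω. Then the linear span of {T*α : T ∈ Sp(V, ω)} together with ω equals all of Λ²V*, i.e. Λ²V* = span{T*α : T*ω = ω} + ℝ·ω. -/
set_option synthInstance.maxHeartbeats 1000000
set_option maxHeartbeats 1000000

noncomputable section

open ExteriorAlgebra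

/-- Pullback of forms by a linear map, i.e. the algebra map on the exterior algebra of the dual
induced by the dual (transpose) map. -/
def pullback {V : Type*} [AddCommGroup V] [Module ℝ V] (T : V →ₗ[ℝ] V) :
    ExteriorAlgebra ℝ (Module.Dual ℝ V) →ₐ[ℝ] ExteriorAlgebra ℝ (Module.Dual ℝ V) :=
  ExteriorAlgebra.map T.dualMap

/-- `formEval` as a linear map in all arguments. -/
def formLin {V : Type*} [AddCommGroup V] [Module ℝ V]
    (x : ExteriorAlgebra ℝ (Module.Dual ℝ V)) : V →ₗ[ℝ] V →ₗ[ℝ] ℝ :=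
  LinearMap.mk₂ ℝ (fun u v => formEval x u v)
    (by intros; simp [formEval]) (by intros; simp [formEval])
    (by intros; simp [formEval]) (by intros; simp [formEval])

section aux

variable {V : Type*} [AddCommGroup V] [Module ℝ V]

lemma formLin_apply (x : ExteriorAlgebra ℝ (Module.Dual ℝ V)) (u v : V) :
    formLin x u v = formEval x u v := rfl

lemma formLin_add (x y : ExteriorAlgebra ℝ (Module.Dual ℝ V)) (u : V) :
    formLin (x + y) u = formLin x u + formLin y u := by
  ext v; simp [formLin_apply, formEval]

lemma formLin_mul (p q : Module.Dual ℝ V) (u : V) :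
    formLin (ι ℝ p * ι ℝ q) u = p u • q - q u • p := by
  ext v
  have h1 : CliffordAlgebra.contractLeft (Module.Dual.eval ℝ V u) (ι ℝ p * ι ℝ q)
      = p u • ι ℝ q - q u • ι ℝ p := by
    refine (CliffordAlgebra.contractLeft_ι_mul (Q := (0 : QuadraticForm ℝ (Module.Dual ℝ V)))
      (Module.Dual.eval ℝ V u) p (ι ℝ q)).trans ?_
    have := CliffordAlgebra.contractLeft_ι (Q := (0 : QuadraticForm ℝ (Module.Dual ℝ V)))
      (Module.Dual.eval ℝ V u) q
    change _ - ι ℝ p * CliffordAlgebra.contractLeft (Module.Dual.eval ℝ V u) (CliffordAlgebra.ι 0 q) = _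
    rw [this, ← Algebra.commutes, ← Algebra.smul_def]
    rfl
  have h2 : ∀ r : Module.Dual ℝ V,
      CliffordAlgebra.contractLeft (Module.Dual.eval ℝ V v) (ι ℝ r)
        = algebraMap ℝ (ExteriorAlgebra ℝ (Module.Dual ℝ V)) (r v) := fun r =>
    CliffordAlgebra.contractLeft_ι (Q := (0 : QuadraticForm ℝ (Module.Dual ℝ V)))
      (Module.Dual.eval ℝ V v) r
  rw [formLin_apply, formEval, h1, map_sub, map_smul, map_smul, h2, h2]
  simp

lemma ext2_eq : ⋀[ℝ]^2 (Module.Dual ℝ V) =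
    LinearMap.range (ι ℝ (M := Module.Dual ℝ V)) * LinearMap.range (ι ℝ (M := Module.Dual ℝ V)) :=
  pow_two (LinearMap.range (ι ℝ (M := Module.Dual ℝ V)))

lemma mul_mem_ext2 (p q : Module.Dual ℝ V) :
    ι ℝ p * ι ℝ q ∈ ⋀[ℝ]^2 (Module.Dual ℝ V) := by
  rw [ext2_eq]
  exact Submodule.mul_mem_mul ⟨p, rfl⟩ ⟨q, rfl⟩

lemma ext2_induction
    {C : ∀ x : ExteriorAlgebra ℝ (Module.Dual ℝ V), x ∈ ⋀[ℝ]^2 (Module.Dual ℝ V) → Prop}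
    (hm : ∀ p q, C (ι ℝ p * ι ℝ q) (mul_mem_ext2 p q))
    (ha : ∀ x y hx hy, C x hx → C y hy → C (x + y) (add_mem hx hy))
    {x : ExteriorAlgebra ℝ (Module.Dual ℝ V)} (hx : x ∈ ⋀[ℝ]^2 (Module.Dual ℝ V)) : C x hx := by
  have h : ∃ h : x ∈ ⋀[ℝ]^2 (Module.Dual ℝ V), C x h := by
    have hx' := hx
    rw [ext2_eq] at hx'
    refine Submodule.mul_induction_on hx' ?_ ?_
    · rintro _ ⟨p, rfl⟩ _ ⟨q, rfl⟩
      exact ⟨_, hm p q⟩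
    · rintro x y ⟨h1, h2⟩ ⟨h3, h4⟩
      exact ⟨_, ha x y h1 h3 h2 h4⟩
  exact h.2

lemma pullback_mul (T : V →ₗ[ℝ] V) (p q : Module.Dual ℝ V) :
    pullback T (ι ℝ p * ι ℝ q) = ι ℝ (p ∘ₗ T) * ι ℝ (q ∘ₗ T) := by
  simp only [pullback, map_mul, ExteriorAlgebra.map_apply_ι]
  rfl

lemma pullback_mem (T : V →ₗ[ℝ] V) {x : ExteriorAlgebra ℝ (Module.Dual ℝ V)}
    (hx : x ∈ ⋀[ℝ]^2 (Module.Dual ℝ V)) : pullback T x ∈ ⋀[ℝ]^2 (Module.Dual ℝ V) := by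
  induction hx using ext2_induction with
  | hm p q => rw [pullback_mul]; exact mul_mem_ext2 _ _
  | ha x y _ _ h1 h2 => rw [map_add]; exact add_mem h1 h2

lemma pullback_pullback (S T : V →ₗ[ℝ] V) (x : ExteriorAlgebra ℝ (Module.Dual ℝ V)) :
    pullback T (pullback S x) = pullback (S ∘ₗ T) x := by
  have := ExteriorAlgebra.map_comp_map (R := ℝ) S.dualMap T.dualMap
  exact congrArg (fun f => f x) this

lemma swap_mul (p q : Module.Dual ℝ V) : ι ℝ p * ι ℝ q = - (ι ℝ q * ι ℝ p) :=
  eq_neg_of_add_eq_zero_left (ι_add_mul_swap p q)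

/-- the transvection `y ↦ y + c r(y) u` -/
def tv (c : ℝ) (r : Module.Dual ℝ V) (u : V) : V →ₗ[ℝ] V :=
  LinearMap.id + c • r.smulRight u

lemma tv_apply (c : ℝ) (r : Module.Dual ℝ V) (u y : V) : tv c r u y = y + (c * r y) • u := by
  simp [tv, smul_smul]

lemma comp_tv (c : ℝ) (r p : Module.Dual ℝ V) (u : V) :
    p ∘ₗ tv c r u = p + (c * p u) • r := by
  ext y; simp [tv_apply]; ring

lemma tv_bij (c : ℝ) (r : Module.Dual ℝ V) (u : V) (h : r u = 0) :
    Function.Bijective (tv c r u) := by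
  refine Function.bijective_iff_has_inverse.2 ⟨tv (-c) r u, ?_, ?_⟩ <;> intro y <;>
    simp [tv_apply, h]

lemma pullback_tv (c : ℝ) (r : Module.Dual ℝ V) (u : V)
    {x : ExteriorAlgebra ℝ (Module.Dual ℝ V)}
    (hx : x ∈ ⋀[ℝ]^2 (Module.Dual ℝ V)) :
    pullback (tv c r u) x = x + c • (ι ℝ r * ι ℝ (formLin x u)) := by
  induction hx using ext2_induction with
  | hm p q =>
    rw [pullback_mul, comp_tv, comp_tv, formLin_mul]
    simp only [map_add, map_sub, map_smul, mul_add, add_mul, mul_sub, smul_mul_assoc,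
      mul_smul_comm, ι_sq_zero, swap_mul p r]
    module
  | ha x y _ _ h1 h2 =>
    rw [map_add, h1, h2, formLin_add, map_add, mul_add]; module

lemma two_smul_eq [FiniteDimensional ℝ V] {κ : Type*} [Fintype κ]
    (e : Module.Basis κ ℝ V) {x : ExteriorAlgebra ℝ (Module.Dual ℝ V)}
    (hx : x ∈ ⋀[ℝ]^2 (Module.Dual ℝ V)) :
    (2 : ℝ) • x = ∑ i, ι ℝ (e.coord i) * ι ℝ (formLin x (e i)) := by
  have key : ∀ p : Module.Dual ℝ V, ∑ i, p (e i) • e.coord i = p := by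
    intro p
    ext v
    conv_rhs => rw [← e.sum_repr v]
    simp
  induction hx using ext2_induction with
  | hm p q =>
    have : ∀ i, ι ℝ (e.coord i) * ι ℝ (formLin (ι ℝ p * ι ℝ q) (e i))
        = ι ℝ (p (e i) • e.coord i) * ι ℝ q - ι ℝ (q (e i) • e.coord i) * ι ℝ p := by
      intro i
      rw [formLin_mul]
      simp only [map_sub, map_smul, mul_sub, smul_mul_assoc, mul_smul_comm]
    simp_rw [this]
    rw [Finset.sum_sub_distrib, ← Finset.sum_mul, ← Finset.sum_mul, ← map_sum, ← map_sum,
      key, key, swap_mul q p]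
    module
  | ha x y _ _ h1 h2 =>
    rw [smul_add, h1, h2, ← Finset.sum_add_distrib]
    simp_rw [formLin_add, map_add, mul_add]

lemma formLin_alt {x : ExteriorAlgebra ℝ (Module.Dual ℝ V)}
    (hx : x ∈ ⋀[ℝ]^2 (Module.Dual ℝ V)) (u v : V) : formLin x u v = - formLin x v u := by
  induction hx using ext2_induction with
  | hm p q => simp [formLin_mul]; ring
  | ha x y _ _ h1 h2 => simp only [formLin_add, LinearMap.add_apply, h1, h2]; ring

lemma exists_smul_of_ker (p q : Module.Dual ℝ V) (h : ∀ u, p u = 0 → q u = 0) :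
    ∃ c : ℝ, q = c • p := by
  have := mem_span_of_iInf_ker_le_ker (ι := Unit) (L := fun _ => p) (K := q)
    (by intro u hu; simp at hu; simpa using h u hu)
  simp only [Set.range_const, Submodule.mem_span_singleton] at this
  obtain ⟨c, hc⟩ := this
  exact ⟨c, hc.symm⟩

lemma exists_smul_of_forall (E : V ≃ₗ[ℝ] Module.Dual ℝ V) (A : V →ₗ[ℝ] Module.Dual ℝ V)
    (h : ∀ v, ∃ c : ℝ, A v = c • E v) : ∃ c : ℝ, ∀ v, A v = c • E v := by
  obtain ⟨c, hc⟩ := LinearMap.exists_eq_smul_id_of_forall_notLinearIndependent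
    (f := E.symm.toLinearMap ∘ₗ A) (by
      intro v hv
      obtain ⟨c, hc⟩ := h v
      rw [LinearIndependent.pair_iff] at hv
      have := hv c (-1) (by simp [hc])
      norm_num at this)
  refine ⟨c, fun v => ?_⟩
  have := congrArg (fun f => E (f v)) hc
  simpa using this

/-- If `ω(a,u) B(b,u) = ω(b,u) B(a,u)` with `a,b` independent then `a` is a relative eigenvector. -/
lemma eigen (E : V ≃ₗ[ℝ] Module.Dual ℝ V) (B : V →ₗ[ℝ] Module.Dual ℝ V) (a b : V)
    (hab : ∀ s t : ℝ, s • a + t • b = 0 → s = 0 ∧ t = 0)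
    (h : ∀ u, E a u * B b u = E b u * B a u) : ∃ c : ℝ, B a = c • E a := by
  have h0 : ∃ u, E a u = 0 ∧ E b u ≠ 0 := by
    by_contra hcon
    push Not at hcon
    obtain ⟨c, hc⟩ := exists_smul_of_ker _ _ hcon
    have : b = c • a := E.injective (by rw [hc, map_smul])
    have := hab c (-1) (by simp [this])
    norm_num at this
  obtain ⟨u0, h1, h2⟩ := h0
  have hgen : ∀ u, E a u = 0 → E b u ≠ 0 → B a u = 0 := by
    intro u hu hu'
    have := h u
    rw [hu, zero_mul] at this
    exact (mul_eq_zero.1 this.symm).resolve_left hu'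
  apply exists_smul_of_ker
  intro u hu
  by_cases hb : E b u = 0
  · have h3 := hgen (u + u0) (by simp [hu, h1]) (by simpa [hb] using h2)
    have h4 := hgen u0 h1 h2
    simpa [h4] using h3
  · exact hgen u hu hb

/-- Propagation of the eigenvector property. -/
lemma propagate (E : V ≃ₗ[ℝ] Module.Dual ℝ V) (hE : ∀ u v, E u v = - E v u)
    (B : V →ₗ[ℝ] Module.Dual ℝ V) (a : V) (ha : a ≠ 0)
    (h : ∀ (t : ℝ) (u : V), ∃ c : ℝ, B (a + (t * E a u) • u) = c • E (a + (t * E a u) • u)) :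
    ∃ c : ℝ, ∀ v, B v = c • E v := by
  obtain ⟨c, hc⟩ := h 0 0
  simp only [smul_zero, add_zero] at hc
  have h1 : ∀ u, E a u ≠ 0 → B u = c • E u := by
    intro u hu
    obtain ⟨d, hd⟩ := h (E a u)⁻¹ u
    obtain ⟨d', hd'⟩ := h (-(E a u)⁻¹) u
    have e1 : (E a u)⁻¹ * E a u = 1 := inv_mul_cancel₀ hu
    have e2 : -(E a u)⁻¹ * E a u = -1 := by rw [neg_mul, e1]
    rw [e1] at hd
    rw [e2] at hd'
    simp only [one_smul, neg_smul, map_add, map_neg, hc] at hd hd'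
    have hau : E a a = 0 := by linarith [hE a a]
    have huu : E u u = 0 := by linarith [hE u u]
    have hs : (c + c - d - d') • E a + (d' - d) • E u = 0 := by
      have : (c • E a + B u) + (c • E a + -B u) = d • (E a + E u) + d' • (E a + -E u) := by
        rw [hd, hd']
      rw [← sub_eq_zero] at this
      rw [← this]; module
    have f1 := congrArg (fun f => f u) hs
    have f2 := congrArg (fun f => f a) hs
    simp only [LinearMap.add_apply, LinearMap.smul_apply, smul_eq_mul, LinearMap.zero_apply,
      huu, hau, mul_zero, add_zero, zero_add] at f1 f2
    have g1 := (mul_eq_zero.1 f1).resolve_right hu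
    have g2 := (mul_eq_zero.1 f2).resolve_right (by rw [hE]; exact neg_ne_zero.2 hu)
    have : d = c := by linarith
    subst this
    rw [smul_add] at hd
    exact add_left_cancel hd
  have h0 : ∃ u0, E a u0 ≠ 0 := by
    by_contra hcon
    push Not at hcon
    exact ha (E.injective (by ext u; simp [hcon]))
  obtain ⟨u0, hu0⟩ := h0
  refine ⟨c, fun v => ?_⟩
  by_cases hv : E a v = 0
  · have h3 := h1 (v + u0) (by simpa [hv] using hu0)
    rw [map_add, map_add, h1 u0 hu0, smul_add] at h3
    exact add_right_cancel h3
  · exact h1 v hv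

end aux

theorem stmt3 {V : Type*} [AddCommGroup V] [Module ℝ V] [FiniteDimensional ℝ V]
    (n : ℕ) (hdim : Module.finrank ℝ V = 2 * n)
    (ω : ExteriorAlgebra ℝ (Module.Dual ℝ V))
    (hω2 : ω ∈ ⋀[ℝ]^2 (Module.Dual ℝ V))
    (hωnd : ∀ u : V, (∀ v : V, formEval ω u v = 0) → u = 0)
    (α : ExteriorAlgebra ℝ (Module.Dual ℝ V))
    (hα2 : α ∈ ⋀[ℝ]^2 (Module.Dual ℝ V))
    (hαnd : ∀ u : V, (∀ v : V, formEval α u v = 0) → u = 0)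
    (hαω : ∀ c : ℝ, α ≠ c • ω) :
    Submodule.span ℝ
        ({x | ∃ T : V →ₗ[ℝ] V, Function.Bijective T ∧ pullback T ω = ω ∧ x = pullback T α}
          ∪ {ω}) =
      ⋀[ℝ]^2 (Module.Dual ℝ V) := by
  classical
  have hWle : Submodule.span ℝ
        ({x | ∃ T : V →ₗ[ℝ] V, Function.Bijective T ∧ pullback T ω = ω ∧ x = pullback T α}
          ∪ {ω}) ≤ ⋀[ℝ]^2 (Module.Dual ℝ V) := by
    rw [Submodule.span_le]
    rintro x (⟨T, -, -, rfl⟩ | rfl)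
    · exact pullback_mem T hα2
    · exact hω2
  refine le_antisymm hWle ?_
  have hαW : α ∈ Submodule.span ℝ
        ({x | ∃ T : V →ₗ[ℝ] V, Function.Bijective T ∧ pullback T ω = ω ∧ x = pullback T α}
          ∪ {ω}) := by
    refine Submodule.subset_span (Or.inl ⟨LinearMap.id, Function.bijective_id, ?_, ?_⟩) <;>
    simp [pullback]
  have hωW : ω ∈ Submodule.span ℝ
        ({x | ∃ T : V →ₗ[ℝ] V, Function.Bijective T ∧ pullback T ω = ω ∧ x = pullback T α}
          ∪ {ω}) := Submodule.subset_span (Or.inr rfl)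
  have hinv : ∀ T : V →ₗ[ℝ] V, Function.Bijective T → pullback T ω = ω →
      ∀ x ∈ Submodule.span ℝ
        ({x | ∃ T : V →ₗ[ℝ] V, Function.Bijective T ∧ pullback T ω = ω ∧ x = pullback T α}
          ∪ {ω}), pullback T x ∈ Submodule.span ℝ
        ({x | ∃ T : V →ₗ[ℝ] V, Function.Bijective T ∧ pullback T ω = ω ∧ x = pullback T α}
          ∪ {ω}) := by
    intro T hT hTω x hx
    induction hx using Submodule.span_induction with
    | mem x hx =>
      rcases hx with ⟨S, hS, hSω, rfl⟩ | rfl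
      · refine Submodule.subset_span (Or.inl ⟨S ∘ₗ T, hS.comp hT, ?_, pullback_pullback _ _ _⟩)
        rw [← pullback_pullback, hSω, hTω]
      · rw [hTω]; exact hωW
    | zero => simp
    | add x y _ _ h1 h2 => rw [map_add]; exact add_mem h1 h2
    | smul c x _ h1 => rw [map_smul]; exact Submodule.smul_mem _ _ h1
  generalize Submodule.span ℝ
        ({x | ∃ T : V →ₗ[ℝ] V, Function.Bijective T ∧ pullback T ω = ω ∧ x = pullback T α}
          ∪ {ω}) = W at *
  -- the isomorphism given by ω
  have hinj : Function.Injective (formLin ω) := by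
    rw [injective_iff_map_eq_zero]
    intro u hu
    exact hωnd u fun v => by rw [← formLin_apply, hu]; rfl
  obtain ⟨E, hEω⟩ : ∃ E : V ≃ₗ[ℝ] Module.Dual ℝ V, ∀ v, formLin ω v = E v :=
    ⟨LinearMap.linearEquivOfInjective (formLin ω) hinj Subspace.dual_finrank_eq.symm,
      fun v => rfl⟩
  have hE : ∀ u v, E u v = - E v u := by
    intro u v; rw [← hEω, ← hEω]; exact formLin_alt hω2 u v
  have hE0 : ∀ u, E u u = 0 := fun u => by linarith [hE u u]
  have htv : ∀ (c : ℝ) (u : V), ∀ x ∈ W, pullback (tv c (E u) u) x ∈ W := by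
    intro c u
    refine hinv _ (tv_bij _ _ _ (hE0 u)) ?_
    rw [pullback_tv _ _ _ hω2, hEω, ι_sq_zero, smul_zero, add_zero]
  have hW1 : ∀ (u : V), ∀ x ∈ W, ι ℝ (E u) * ι ℝ (formLin x u) ∈ W := by
    intro u x hx
    have := sub_mem (htv 1 u x hx) hx
    rwa [pullback_tv _ _ _ (hWle hx), one_smul, add_sub_cancel_left] at this
  let e := Module.finBasis ℝ V
  -- a decomposable element
  have hdec : ∃ a b : V, (∀ s t : ℝ, s • a + t • b = 0 → s = 0 ∧ t = 0) ∧
      ι ℝ (E a) * ι ℝ (E b) ∈ W := by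
    have hv : ∃ v, ∀ c : ℝ, formLin α v ≠ c • E v := by
      by_contra hcon
      push Not at hcon
      obtain ⟨c, hc⟩ := exists_smul_of_forall E (formLin α) hcon
      apply hαω c
      have h1 := two_smul_eq e hα2
      have h2 := two_smul_eq e hω2
      simp_rw [hc, map_smul, mul_smul_comm, ← hEω] at h1
      rw [← Finset.smul_sum, ← h2, smul_comm] at h1
      exact smul_right_injective _ (two_ne_zero (α := ℝ)) h1
    obtain ⟨v, hv⟩ := hv
    refine ⟨v, E.symm (formLin α v), ?_, ?_⟩
    · intro s t hst
      have h1 := congrArg E hst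
      simp only [map_add, map_smul, LinearEquiv.apply_symm_apply, map_zero] at h1
      have ht : t = 0 := by
        by_contra ht
        apply hv (-(t⁻¹ * s))
        have : t⁻¹ • (s • E v + t • formLin α v) = 0 := by rw [h1, smul_zero]
        rw [smul_add, smul_smul, smul_smul, inv_mul_cancel₀ ht, one_smul] at this
        exact (eq_neg_of_add_eq_zero_right this).trans (neg_smul _ _).symm
      subst ht
      rw [zero_smul, add_zero] at h1
      refine ⟨?_, rfl⟩
      rcases smul_eq_zero.1 h1 with h | h
      · exact h
      · exfalso
        have hv0 : v = 0 := E.injective (by rw [h, map_zero])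
        exact hv 0 (by simp [hv0])
    · rw [LinearEquiv.apply_symm_apply]
      exact hW1 v α hαW
  obtain ⟨a, b, hab, habW⟩ := hdec
  have ha : a ≠ 0 := by
    rintro rfl
    have := hab 1 0 (by simp)
    norm_num at this
  by_contra hnle
  obtain ⟨x, hx2, hxW⟩ := SetLike.not_le_iff_exists.1 hnle
  obtain ⟨φ, hφx, hφW⟩ := Submodule.exists_le_ker_of_notMem hxW
  replace hφW : ∀ y ∈ W, φ y = 0 := fun y hy => hφW hy
  let B : V →ₗ[ℝ] Module.Dual ℝ V := LinearMap.mk₂ ℝ (fun u v => φ (ι ℝ (E u) * ι ℝ (E v)))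
    (by intros; simp [add_mul]) (by intros; simp)
    (by intros; simp [mul_add]) (by intros; simp)
  have hB : ∀ u v, B u v = φ (ι ℝ (E u) * ι ℝ (E v)) := fun u v => rfl
  have hBalt : ∀ u v, B u v = - B v u := by
    intro u v; rw [hB, hB, swap_mul, map_neg]
  have heig : ∀ a b : V, (∀ s t : ℝ, s • a + t • b = 0 → s = 0 ∧ t = 0) →
      ι ℝ (E a) * ι ℝ (E b) ∈ W → ∃ c : ℝ, B a = c • E a := by
    intro a b hab habW
    refine eigen E B a b hab fun u => ?_
    have h1 := hφW _ (hW1 u _ habW)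
    rw [formLin_mul] at h1
    simp only [map_sub, map_smul, mul_sub, mul_smul_comm, ← hB, smul_eq_mul] at h1
    rw [hBalt b u, hBalt a u]
    linarith
  obtain ⟨c, hc⟩ := propagate E hE B a ha (by
    intro t u
    refine heig _ (b + (t * E b u) • u) ?_ ?_
    · intro s r hsr
      apply hab
      have h1 : (s • a + r • b) + (t * E (s • a + r • b) u) • u = 0 := by
        rw [← hsr]
        simp only [map_add, map_smul, LinearMap.add_apply, LinearMap.smul_apply, smul_eq_mul]
        module
      have h2 := congrArg (fun z => E z u) h1
      simp only [map_add (E) (s • a + r • b), map_smul E (_ * _), LinearMap.add_apply,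
        LinearMap.smul_apply, hE0, smul_zero, add_zero, map_zero, LinearMap.zero_apply] at h2
      rw [h2] at h1
      simpa using h1
    · have h1 := htv t u _ habW
      rw [pullback_mul, comp_tv, comp_tv] at h1
      simpa only [map_add, map_smul] using h1)
  have hc0 : c = 0 := by
    have h2 := congrArg φ (two_smul_eq e hω2)
    rw [map_smul, hφW _ hωW, map_sum] at h2
    have h3 : ∀ i, φ (ι ℝ (e.coord i) * ι ℝ (formLin ω (e i))) = c := by
      intro i
      have := hB (E.symm (e.coord i)) (e i)
      rw [LinearEquiv.apply_symm_apply, hc] at this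
      rw [hEω, ← this]
      simp
    simp_rw [h3] at h2
    simp only [smul_zero, Finset.sum_const, Finset.card_univ, Fintype.card_fin,
      nsmul_eq_mul] at h2
    have : Nontrivial V := ⟨a, 0, ha⟩
    have hp : 0 < Module.finrank ℝ V := Module.finrank_pos
    rcases mul_eq_zero.1 h2.symm with h | h
    · have : Module.finrank ℝ V = 0 := by exact_mod_cast h
      omega
    · exact h
  apply hφx
  clear hφx hxW
  induction hx2 using ext2_induction with
  | hm p q =>
    have := hB (E.symm p) (E.symm q)
    rw [hc, hc0] at this
    simpa using this.symm
  | ha x y _ _ h1 h2 => rw [map_add, h1, h2, add_zero]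
end
end

section
/- Let (V, g, J) be a 2n-dimensional real inner product space with compatible almost complex structure, ω = g(J·,·), and L(α) = ω ∧ α. Then for every k ≤ n, the map L^{n-k} : Λ^k V* → Λ^{2n-k} V* given by α ↦ ω^{n-k} ∧ α is bijective (the hard Lefschetz isomorphism at the linear level). -/
set_option synthInstance.maxHeartbeats 1000000
set_option maxHeartbeats 1000000

noncomputable section

open ExteriorAlgebra

/-- The vector representing a linear functional via the inner product (musical isomorphism). -/
def sharp {V : Type*} [NormedAddCommGroup V] [InnerProductSpace ℝ V] [FiniteDimensional ℝ V]
    (f : Module.Dual ℝ V) : V :=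
  (InnerProductSpace.toDual ℝ V).symm (LinearMap.toContinuousLinearMap f)

/-- The inner product induced on the dual space by the inner product of `V`. -/
def gd {V : Type*} [NormedAddCommGroup V] [InnerProductSpace ℝ V] [FiniteDimensional ℝ V]
    (f g : Module.Dual ℝ V) : ℝ :=
  inner (𝕜 := ℝ) (sharp f) (sharp g)

/-- `B` is the inner product on the exterior algebra of the dual of `V` induced by the metric:
it is determined by `⟨u₁∧…∧u_m, v₁∧…∧v_m⟩ = det(⟨uᵢ,vⱼ⟩)` together with orthogonality of
forms of distinct degrees. -/
def IsInducedInner {V : Type*} [NormedAddCommGroup V] [InnerProductSpace ℝ V]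
    [FiniteDimensional ℝ V]
    (B : ExteriorAlgebra ℝ (Module.Dual ℝ V) →ₗ[ℝ] ExteriorAlgebra ℝ (Module.Dual ℝ V) →ₗ[ℝ] ℝ) :
    Prop :=
  (∀ (m : ℕ) (u v : Fin m → Module.Dual ℝ V),
      B (ιMulti ℝ m u) (ιMulti ℝ m v) = Matrix.det (Matrix.of fun i j => gd (u i) (v j))) ∧
    ∀ (p q : ℕ), p ≠ q → ∀ x ∈ ⋀[ℝ]^p (Module.Dual ℝ V), ∀ y ∈ ⋀[ℝ]^q (Module.Dual ℝ V),
      B x y = 0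

namespace HL

/-- Interior product with `v`. -/
def ctr {V : Type*} [AddCommGroup V] [Module ℝ V] (v : V) :
    ExteriorAlgebra ℝ (Module.Dual ℝ V) →ₗ[ℝ] ExteriorAlgebra ℝ (Module.Dual ℝ V) :=
  CliffordAlgebra.contractLeft (Module.Dual.eval ℝ V v)

section alg
variable {V : Type*} [AddCommGroup V] [Module ℝ V]

lemma ctr_ι_mul (v : V) (a : Module.Dual ℝ V) (x : ExteriorAlgebra ℝ (Module.Dual ℝ V)) :
    ctr v (ι ℝ a * x) = a v • x - ι ℝ a * ctr v x :=
  CliffordAlgebra.contractLeft_ι_mul _ _ _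

lemma ctr_ι (v : V) (a : Module.Dual ℝ V) :
    ctr v (ι ℝ a) = algebraMap ℝ _ (a v) :=
  CliffordAlgebra.contractLeft_ι _ _ _

lemma ctr_algebraMap (v : V) (r : ℝ) :
    ctr v (algebraMap ℝ (ExteriorAlgebra ℝ (Module.Dual ℝ V)) r) = 0 :=
  CliffordAlgebra.contractLeft_algebraMap _ _ _

lemma ctr_zero (v : V) {x : ExteriorAlgebra ℝ (Module.Dual ℝ V)}
    (hx : x ∈ ⋀[ℝ]^0 (Module.Dual ℝ V)) : ctr v x = 0 := by
  rw [exteriorPower, pow_zero, Submodule.mem_one] at hx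
  obtain ⟨r, rfl⟩ := hx
  exact ctr_algebraMap v r

lemma ctr_mem (v : V) {k : ℕ} {x : ExteriorAlgebra ℝ (Module.Dual ℝ V)}
    (hx : x ∈ ⋀[ℝ]^k (Module.Dual ℝ V)) : ctr v x ∈ ⋀[ℝ]^(k - 1) (Module.Dual ℝ V) := by
  rw [exteriorPower] at hx
  induction hx using Submodule.pow_induction_on_left' with
  | algebraMap r => rw [ctr_algebraMap]; exact zero_mem _
  | add x y i hx hy h1 h2 => rw [map_add]; exact add_mem h1 h2
  | mem_mul m hm i x hx ih =>
    obtain ⟨a, rfl⟩ := hm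
    rw [ctr_ι_mul]
    refine sub_mem (Submodule.smul_mem _ _ hx) ?_
    rcases i with _ | i
    · rw [ctr_zero v hx, mul_zero]; exact zero_mem _
    · simp only [Nat.succ_eq_add_one, Nat.add_sub_cancel] at ih ⊢
      rw [exteriorPower, pow_succ']
      exact Submodule.mul_mem_mul ⟨a, rfl⟩ ih

lemma two_induction {p : ExteriorAlgebra ℝ (Module.Dual ℝ V) → Prop}
    {ω : ExteriorAlgebra ℝ (Module.Dual ℝ V)} (hω : ω ∈ ⋀[ℝ]^2 (Module.Dual ℝ V))
    (h1 : ∀ a b : Module.Dual ℝ V, p (ι ℝ a * ι ℝ b)) (h2 : ∀ x y, p x → p y → p (x + y)) :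
    p ω := by
  rw [exteriorPower, pow_two] at hω
  refine Submodule.mul_induction_on hω ?_ h2
  rintro _ ⟨a, rfl⟩ _ ⟨b, rfl⟩
  exact h1 a b

lemma ctr_omega_mul {ω : ExteriorAlgebra ℝ (Module.Dual ℝ V)}
    (hω : ω ∈ ⋀[ℝ]^2 (Module.Dual ℝ V)) (v : V) (x : ExteriorAlgebra ℝ (Module.Dual ℝ V)) :
    ctr v (ω * x) = ctr v ω * x + ω * ctr v x := by
  refine two_induction hω (p := fun ω => ctr v (ω * x) = ctr v ω * x + ω * ctr v x) ?_ ?_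
  · intro a b
    rw [mul_assoc, ctr_ι_mul, ctr_ι_mul, ctr_ι_mul, ctr_ι, mul_sub, sub_mul,
      ← Algebra.commutes, ← Algebra.smul_def]
    simp only [mul_assoc, smul_mul_assoc, mul_smul_comm]
    abel
  · intro y z hy hz
    rw [add_mul, map_add, map_add, hy, hz]
    noncomm_ring

lemma ι_anti (a b : Module.Dual ℝ V) : ι ℝ a * ι ℝ b = - (ι ℝ b * ι ℝ a) :=
  eq_neg_of_add_eq_zero_left (ι_add_mul_swap a b)

lemma omega_comm {ω : ExteriorAlgebra ℝ (Module.Dual ℝ V)}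
    (hω : ω ∈ ⋀[ℝ]^2 (Module.Dual ℝ V)) (c : Module.Dual ℝ V) :
    ω * ι ℝ c = ι ℝ c * ω := by
  refine two_induction hω (p := fun ω => ω * ι ℝ c = ι ℝ c * ω) ?_ ?_
  · intro a b
    rw [mul_assoc, ι_anti b c, mul_neg, ← mul_assoc, ι_anti a c, neg_mul, neg_neg, mul_assoc]
  · intro y z hy hz
    rw [add_mul, mul_add, hy, hz]

/-- Number operator. -/
lemma number {I : Type*} [Fintype I] (f : I → V) (t : I → Module.Dual ℝ V)
    (h : ∀ a : Module.Dual ℝ V, ∑ i, a (f i) • t i = a) {k : ℕ}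
    {x : ExteriorAlgebra ℝ (Module.Dual ℝ V)} (hx : x ∈ ⋀[ℝ]^k (Module.Dual ℝ V)) :
    ∑ i, ι ℝ (t i) * ctr (f i) x = (k : ℝ) • x := by
  rw [exteriorPower] at hx
  induction hx using Submodule.pow_induction_on_left' with
  | algebraMap r => simp [ctr_algebraMap]
  | add x y i hx hy h1 h2 => simp only [map_add, mul_add, Finset.sum_add_distrib, h1, h2, smul_add]
  | mem_mul m hm i x hx ih =>
    obtain ⟨a, rfl⟩ := hm
    have h1 : ∀ j, ι ℝ (t j) * ctr (f j) (ι ℝ a * x) =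
        ι ℝ (a (f j) • t j) * x + ι ℝ a * (ι ℝ (t j) * ctr (f j) x) := by
      intro j
      rw [ctr_ι_mul, mul_sub, ← mul_assoc, ← mul_assoc, ι_anti a (t j), map_smul]
      simp [sub_eq_add_neg]
    simp only [h1, Finset.sum_add_distrib, ← Finset.sum_mul, ← Finset.mul_sum, ih, ← map_sum, h]
    rw [Nat.succ_eq_add_one, Nat.cast_add, add_smul, mul_smul_comm, Nat.cast_one, one_smul,
      add_comm]

lemma pow_mul_mem {ω : ExteriorAlgebra ℝ (Module.Dual ℝ V)}
    (hω : ω ∈ ⋀[ℝ]^2 (Module.Dual ℝ V)) {k : ℕ} (r : ℕ)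
    {x : ExteriorAlgebra ℝ (Module.Dual ℝ V)} (hx : x ∈ ⋀[ℝ]^k (Module.Dual ℝ V)) :
    ω ^ r * x ∈ ⋀[ℝ]^(2 * r + k) (Module.Dual ℝ V) := by
  rw [exteriorPower] at hω hx ⊢
  rw [pow_add, pow_mul]
  exact Submodule.mul_mem_mul (Submodule.pow_mem_pow _ hω r) hx

lemma comm_pow {ω : ExteriorAlgebra ℝ (Module.Dual ℝ V)}
    (hω : ω ∈ ⋀[ℝ]^2 (Module.Dual ℝ V)) (n : ℕ)
    (Λ : ExteriorAlgebra ℝ (Module.Dual ℝ V) →ₗ[ℝ] ExteriorAlgebra ℝ (Module.Dual ℝ V))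
    (hΛ : ∀ k : ℕ, ∀ x ∈ ⋀[ℝ]^k (Module.Dual ℝ V),
      Λ (ω * x) = ω * Λ x + ((n : ℝ) - k) • x)
    {k : ℕ} {x : ExteriorAlgebra ℝ (Module.Dual ℝ V)} (hx : x ∈ ⋀[ℝ]^k (Module.Dual ℝ V))
    (r : ℕ) :
    Λ (ω ^ (r + 1) * x) = ω ^ (r + 1) * Λ x + (((r : ℝ) + 1) * ((n : ℝ) - k - r)) • (ω ^ r * x) := by
  induction r with
  | zero => simp [hΛ k x hx]
  | succ r ih =>
    rw [pow_succ' ω (r + 1), mul_assoc, hΛ _ _ (pow_mul_mem hω (r + 1) hx), ih, mul_add,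
      mul_smul_comm, ← mul_assoc, ← mul_assoc, ← pow_succ', ← pow_succ', add_assoc, ← add_smul]
    congr 2
    push_cast
    ring

lemma inj {ω : ExteriorAlgebra ℝ (Module.Dual ℝ V)}
    (hω : ω ∈ ⋀[ℝ]^2 (Module.Dual ℝ V)) (n : ℕ)
    (Λ : ExteriorAlgebra ℝ (Module.Dual ℝ V) →ₗ[ℝ] ExteriorAlgebra ℝ (Module.Dual ℝ V))
    (hΛ : ∀ k : ℕ, ∀ x ∈ ⋀[ℝ]^k (Module.Dual ℝ V),
      Λ (ω * x) = ω * Λ x + ((n : ℝ) - k) • x)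
    (h0 : ∀ k < 2, ∀ x ∈ ⋀[ℝ]^k (Module.Dual ℝ V), Λ x = 0)
    (h2 : ∀ k, ∀ x ∈ ⋀[ℝ]^(k + 2) (Module.Dual ℝ V), Λ x ∈ ⋀[ℝ]^k (Module.Dual ℝ V))
    (k : ℕ) : k ≤ n → ∀ x ∈ ⋀[ℝ]^k (Module.Dual ℝ V), ω ^ (n - k) * x = 0 → x = 0 := by
  induction k using Nat.strong_induction_on with
  | _ k IH =>
    intro hk x hx hz
    have hprim : Λ x = 0 := by
      rcases lt_or_ge k 2 with h | h
      · exact h0 k h x hx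
      · obtain ⟨j, rfl⟩ := Nat.exists_eq_add_of_le' h
        have hc := comm_pow hω n Λ hΛ hx (n - (j + 2))
        rw [hz, smul_zero, add_zero, pow_succ', mul_assoc, hz, mul_zero, map_zero] at hc
        refine IH j (by omega) (by omega) _ (h2 j x hx) ?_
        have e : n - j = (n - (j + 2) + 1) + 1 := by omega
        rw [e, pow_succ' ω (n - (j + 2) + 1), pow_succ', mul_assoc, ← hc, mul_zero]
    have key : ∀ r ≤ n - k, ω ^ r * x = 0 → x = 0 := by
      intro r
      induction r with
      | zero => intro _ h; simpa using h
      | succ r ih =>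
        intro hr h
        apply ih (by omega)
        have hc := comm_pow hω n Λ hΛ hx r
        rw [h, hprim, mul_zero, zero_add, map_zero] at hc
        refine (smul_eq_zero.mp hc.symm).resolve_left ?_
        have h3 : (r : ℝ) + 1 + k ≤ n := by exact_mod_cast (by omega : r + 1 + k ≤ n)
        have h4 : (0 : ℝ) ≤ r := by positivity
        apply ne_of_gt
        apply mul_pos <;> linarith
    exact key _ le_rfl hz

lemma ctr_omega {ω : ExteriorAlgebra ℝ (Module.Dual ℝ V)}
    (hω : ω ∈ ⋀[ℝ]^2 (Module.Dual ℝ V)) (v : V) (t : Module.Dual ℝ V)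
    (h : ∀ w, formEval ω v w = t w) : ctr v ω = ι ℝ t := by
  have h1 := ctr_mem v hω
  rw [exteriorPower, Nat.add_one_sub_one, pow_one] at h1
  obtain ⟨a, ha⟩ := h1
  rw [← ha]
  congr 1
  ext w
  rw [← h w]
  change _ = algebraMapInv (ctr w (ctr v ω))
  rw [← ha, ctr_ι, algebraMap_leftInverse]

end alg

end HL

theorem stmt9
    {V : Type*} [NormedAddCommGroup V] [InnerProductSpace ℝ V] [FiniteDimensional ℝ V]
    (n : ℕ) (hdim : Module.finrank ℝ V = 2 * n)
    (J : V →ₗ[ℝ] V) (hJ2 : J ∘ₗ J = -LinearMap.id)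
    (hJg : ∀ u v : V, inner (𝕜 := ℝ) (J u) (J v) = inner (𝕜 := ℝ) u v)
    (ω : ExteriorAlgebra ℝ (Module.Dual ℝ V))
    (hω2 : ω ∈ ⋀[ℝ]^2 (Module.Dual ℝ V))
    (hωJ : ∀ u v : V, formEval ω u v = inner (𝕜 := ℝ) (J u) v)
    (B : ExteriorAlgebra ℝ (Module.Dual ℝ V) →ₗ[ℝ] ExteriorAlgebra ℝ (Module.Dual ℝ V) →ₗ[ℝ] ℝ)
    (hB : IsInducedInner B)
    (k : ℕ) (hk : k ≤ n) :
    (∀ x ∈ ⋀[ℝ]^k (Module.Dual ℝ V), ω ^ (n - k) * x ∈ ⋀[ℝ]^(2 * n - k) (Module.Dual ℝ V)) ∧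
    (∀ x ∈ ⋀[ℝ]^k (Module.Dual ℝ V), ∀ y ∈ ⋀[ℝ]^k (Module.Dual ℝ V),
      ω ^ (n - k) * x = ω ^ (n - k) * y → x = y) ∧
    (∀ z ∈ ⋀[ℝ]^(2 * n - k) (Module.Dual ℝ V),
      ∃ x ∈ ⋀[ℝ]^k (Module.Dual ℝ V), ω ^ (n - k) * x = z) := by
  have hJJ : ∀ v, J (J v) = -v := fun v => by
    have := LinearMap.congr_fun hJ2 v
    simpa using this
  have hskew : ∀ u v : V, inner ℝ (J u) v = - inner ℝ u (J v) := fun u v => by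
    rw [← hJg u (J v), hJJ, inner_neg_right, neg_neg]
  let b := stdOrthonormalBasis ℝ V
  let fl : V → Module.Dual ℝ V := fun v => (innerₗ V v)
  have hfl : ∀ u v, fl u v = inner ℝ u v := fun u v => rfl
  have hθ : ∀ v, HL.ctr v ω = ι ℝ (fl (J v)) := fun v =>
    HL.ctr_omega hω2 v _ (fun w => by rw [hωJ, hfl])
  have hb : ∀ a : Module.Dual ℝ V, ∑ i, a (b i) • fl (b i) = a := by
    intro a
    ext v
    conv_rhs => rw [← b.sum_repr' v]
    simp [hfl, mul_comm]
  have hJb : ∀ a : Module.Dual ℝ V, ∑ i, a (J (b i)) • fl (J (b i)) = a := by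
    intro a
    ext v
    have h1 : v = J (-(J v)) := by rw [map_neg, hJJ, neg_neg]
    conv_rhs => rw [h1, ← b.sum_repr' (-(J v))]
    simp [hfl, mul_comm, hskew]
  let Λ : ExteriorAlgebra ℝ (Module.Dual ℝ V) →ₗ[ℝ] ExteriorAlgebra ℝ (Module.Dual ℝ V) :=
    (1 / 2 : ℝ) • ∑ i, (HL.ctr (J (b i))) ∘ₗ (HL.ctr (b i))
  have hΛdef : ∀ x, Λ x = (1 / 2 : ℝ) • ∑ i, HL.ctr (J (b i)) (HL.ctr (b i) x) := by
    intro x; simp [Λ]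
  have hΛ : ∀ k : ℕ, ∀ x ∈ ⋀[ℝ]^k (Module.Dual ℝ V),
      Λ (ω * x) = ω * Λ x + ((n : ℝ) - k) • x := by
    intro k x hx
    have h1 : ∀ i, HL.ctr (J (b i)) (HL.ctr (b i) (ω * x)) =
        x - ι ℝ (fl (J (b i))) * HL.ctr (J (b i)) x - ι ℝ (fl (b i)) * HL.ctr (b i) x
          + ω * HL.ctr (J (b i)) (HL.ctr (b i) x) := by
      intro i
      have h3 : fl (J (b i)) (J (b i)) = 1 := by
        rw [hfl, hJg, real_inner_self_eq_norm_sq]; simp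
      have h4 : fl (J (J (b i))) = - fl (b i) := by
        rw [hJJ]; simp [fl]
      rw [HL.ctr_omega_mul hω2, map_add, HL.ctr_omega_mul hω2, hθ, hθ, HL.ctr_ι_mul, h3, h4,
        map_neg, one_smul, neg_mul]
      abel
    have hc : (Fintype.card (Fin (Module.finrank ℝ V)) : ℝ) = 2 * n := by
      rw [Fintype.card_fin, hdim]; push_cast; rfl
    rw [hΛdef, hΛdef]
    simp only [h1, Finset.sum_add_distrib, Finset.sum_sub_distrib, ← Finset.mul_sum]
    rw [HL.number _ _ hb hx, HL.number (fun i => J (b i)) (fun i => fl (J (b i))) hJb hx,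
      Finset.sum_const, Finset.card_univ, ← Nat.cast_smul_eq_nsmul ℝ, hc, mul_smul_comm]
    module
  have h2 : ∀ k, ∀ x ∈ ⋀[ℝ]^(k + 2) (Module.Dual ℝ V), Λ x ∈ ⋀[ℝ]^k (Module.Dual ℝ V) := by
    intro k x hx
    rw [hΛdef]
    exact Submodule.smul_mem _ _ (Submodule.sum_mem _ fun i _ => HL.ctr_mem _ (HL.ctr_mem _ hx))
  have h0 : ∀ k < 2, ∀ x ∈ ⋀[ℝ]^k (Module.Dual ℝ V), Λ x = 0 := by
    intro k hk x hx
    rw [hΛdef, Finset.sum_eq_zero, smul_zero]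
    intro i _
    apply HL.ctr_zero
    have := HL.ctr_mem (b i) hx
    rwa [show k - 1 = 0 by omega] at this
  have hmem : ∀ x ∈ ⋀[ℝ]^k (Module.Dual ℝ V),
      ω ^ (n - k) * x ∈ ⋀[ℝ]^(2 * n - k) (Module.Dual ℝ V) := by
    intro x hx
    have := HL.pow_mul_mem hω2 (n - k) hx
    rwa [show 2 * (n - k) + k = 2 * n - k by omega] at this
  have hinj : ∀ x ∈ ⋀[ℝ]^k (Module.Dual ℝ V), ∀ y ∈ ⋀[ℝ]^k (Module.Dual ℝ V),
      ω ^ (n - k) * x = ω ^ (n - k) * y → x = y := by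
    intro x hx y hy h
    rw [← sub_eq_zero]
    refine HL.inj hω2 n Λ hΛ h0 h2 k hk _ (sub_mem hx hy) ?_
    rw [mul_sub, h, sub_self]
  refine ⟨hmem, hinj, ?_⟩
  let T : ⋀[ℝ]^k (Module.Dual ℝ V) →ₗ[ℝ] ⋀[ℝ]^(2 * n - k) (Module.Dual ℝ V) :=
    (LinearMap.mulLeft ℝ (ω ^ (n - k))).restrict hmem
  have hT : Function.Injective T := by
    intro x y h
    exact Subtype.ext (hinj x x.2 y y.2 (congrArg Subtype.val h))
  have hfin : Module.finrank ℝ (⋀[ℝ]^k (Module.Dual ℝ V)) =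
      Module.finrank ℝ (⋀[ℝ]^(2 * n - k) (Module.Dual ℝ V)) := by
    rw [exteriorPower.finrank_eq, exteriorPower.finrank_eq, Subspace.dual_finrank_eq, hdim,
      Nat.choose_symm (by omega)]
  have hS := (LinearMap.injective_iff_surjective_of_finrank_eq_finrank hfin).mp hT
  intro z hz
  obtain ⟨x, hx⟩ := hS ⟨z, hz⟩
  exact ⟨x, x.2, congrArg Subtype.val hx⟩
end
end

section
/- Let (V, g, J) be a 2n-dimensional real inner product space with compatible almost complex structure, L wedging with ω, Λ its adjoint, P^k = ker(Λ) ∩ Λ^k V*. Then every k-form decomposes: Λ^k V* = ⊕_{i≥0} L^i(P^{k−2i}) (Lefschetz decomposition). -/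
set_option synthInstance.maxHeartbeats 1000000
set_option maxHeartbeats 1000000

noncomputable section

open ExteriorAlgebra

/-- Contraction of a form with a vector. -/
def ct {V : Type*} [AddCommGroup V] [Module ℝ V] (v : V) :
    ExteriorAlgebra ℝ (Module.Dual ℝ V) →ₗ[ℝ] ExteriorAlgebra ℝ (Module.Dual ℝ V) :=
  CliffordAlgebra.contractLeft (Module.Dual.eval ℝ V v)

section general

variable {V : Type*} [AddCommGroup V] [Module ℝ V]

lemma ct_ι_mul (v : V) (f : Module.Dual ℝ V) (x : ExteriorAlgebra ℝ (Module.Dual ℝ V)) :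
    ct v (ι ℝ f * x) = f v • x - ι ℝ f * ct v x :=
  CliffordAlgebra.contractLeft_ι_mul _ _ _

lemma ct_ι (v : V) (f : Module.Dual ℝ V) :
    ct v (ι ℝ f) = algebraMap ℝ _ (f v) :=
  CliffordAlgebra.contractLeft_ι _ _ _

lemma ct_algebraMap (v : V) (r : ℝ) :
    ct v (algebraMap ℝ (ExteriorAlgebra ℝ (Module.Dual ℝ V)) r) = 0 :=
  CliffordAlgebra.contractLeft_algebraMap _ _ _

lemma ct_zero_form (v : V) (x : ExteriorAlgebra ℝ (Module.Dual ℝ V))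
    (hx : x ∈ ⋀[ℝ]^0 (Module.Dual ℝ V)) : ct v x = 0 := by
  rw [exteriorPower, pow_zero, Submodule.mem_one] at hx
  obtain ⟨r, rfl⟩ := hx
  exact ct_algebraMap v r

lemma form_succ_induction (k : ℕ) {C : ExteriorAlgebra ℝ (Module.Dual ℝ V) → Prop}
    (hmul : ∀ (f : Module.Dual ℝ V) (y : ExteriorAlgebra ℝ (Module.Dual ℝ V)),
      y ∈ ⋀[ℝ]^k (Module.Dual ℝ V) → C (ι ℝ f * y))
    (hadd : ∀ x y, C x → C y → C (x + y))
    (x : ExteriorAlgebra ℝ (Module.Dual ℝ V))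
    (hx : x ∈ ⋀[ℝ]^(k + 1) (Module.Dual ℝ V)) : C x := by
  rw [exteriorPower, pow_succ'] at hx
  refine Submodule.mul_induction_on hx ?_ hadd
  rintro _ ⟨f, rfl⟩ y hy
  exact hmul f y hy

lemma ι_mul_mem (k : ℕ) (f : Module.Dual ℝ V) (y : ExteriorAlgebra ℝ (Module.Dual ℝ V))
    (hy : y ∈ ⋀[ℝ]^k (Module.Dual ℝ V)) : ι ℝ f * y ∈ ⋀[ℝ]^(k + 1) (Module.Dual ℝ V) := by
  rw [exteriorPower, pow_succ']
  exact Submodule.mul_mem_mul ⟨f, rfl⟩ hy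

lemma ct_mem (v : V) (k : ℕ) : ∀ (x : ExteriorAlgebra ℝ (Module.Dual ℝ V)),
    x ∈ ⋀[ℝ]^(k + 1) (Module.Dual ℝ V) → ct v x ∈ ⋀[ℝ]^k (Module.Dual ℝ V) := by
  induction k with
  | zero =>
    refine form_succ_induction 0 ?_ ?_
    · intro f y hy
      rw [ct_ι_mul, ct_zero_form v y hy, mul_zero, sub_zero]
      exact Submodule.smul_mem _ _ hy
    · intro x y hx hy
      rw [map_add]; exact Submodule.add_mem _ hx hy
  | succ k ih =>
    refine form_succ_induction (k + 1) ?_ ?_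
    · intro f y hy
      rw [ct_ι_mul]
      exact Submodule.sub_mem _ (Submodule.smul_mem _ _ hy) (ι_mul_mem k f _ (ih y hy))
    · intro x y hx hy
      rw [map_add]; exact Submodule.add_mem _ hx hy

/-- The degree operator. -/
lemma degree_op {I : Type*} [Fintype I] (f : I → Module.Dual ℝ V) (v : I → V)
    (hfv : ∀ h : Module.Dual ℝ V, ∑ i, h (v i) • f i = h) (k : ℕ) :
    ∀ x : ExteriorAlgebra ℝ (Module.Dual ℝ V), x ∈ ⋀[ℝ]^k (Module.Dual ℝ V) →
      ∑ i, ι ℝ (f i) * ct (v i) x = (k : ℝ) • x := by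
  induction k with
  | zero =>
    intro x hx
    simp [ct_zero_form _ x hx]
  | succ k ih =>
    refine form_succ_induction k ?_ ?_
    · intro h y hy
      have h1 : ∀ i, ι ℝ (f i) * ct (v i) (ι ℝ h * y)
          = ι ℝ (h (v i) • f i) * y + ι ℝ h * (ι ℝ (f i) * ct (v i) y) := by
        intro i
        have h2 : ι ℝ (f i) * ι ℝ h = - (ι ℝ h * ι ℝ (f i)) :=
          eq_neg_of_add_eq_zero_left (ι_add_mul_swap _ _)
        rw [ct_ι_mul, mul_sub, ← mul_assoc, h2, map_smul, smul_mul_assoc, mul_smul_comm,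
          neg_mul, sub_neg_eq_add, mul_assoc]
      rw [Finset.sum_congr rfl (fun i _ => h1 i), Finset.sum_add_distrib, ← Finset.sum_mul,
        ← map_sum, hfv, ← Finset.mul_sum, ih y hy, mul_smul_comm]
      push_cast
      rw [add_smul, one_smul, add_comm]
    · intro x y hx hy
      rw [smul_add, ← hx, ← hy, ← Finset.sum_add_distrib]
      simp [mul_add]

lemma ct_two_mul (v : V) (w x : ExteriorAlgebra ℝ (Module.Dual ℝ V))
    (hw : w ∈ ⋀[ℝ]^2 (Module.Dual ℝ V)) : ct v (w * x) = ct v w * x + w * ct v x := by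
  refine form_succ_induction (C := fun w => ct v (w * x) = ct v w * x + w * ct v x) 1 ?_ ?_ w hw
  · intro f y hy
    rw [exteriorPower, pow_one] at hy
    obtain ⟨g, rfl⟩ := hy
    rw [mul_assoc, ct_ι_mul, ct_ι_mul, ct_ι_mul, ct_ι, ← Algebra.commutes, ← Algebra.smul_def]
    simp only [mul_sub, sub_mul, smul_mul_assoc, mul_smul_comm, mul_assoc]
    abel
  · intro a b ha hb
    rw [add_mul, map_add, ha, hb, map_add, add_mul, add_mul]; abel

lemma ct_two (v : V) (w : ExteriorAlgebra ℝ (Module.Dual ℝ V))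
    (hw : w ∈ ⋀[ℝ]^2 (Module.Dual ℝ V)) (h : Module.Dual ℝ V)
    (hh : ∀ u, formEval w v u = h u) : ct v w = ι ℝ h := by
  have := ct_mem v 1 w hw
  rw [exteriorPower, pow_one] at this
  obtain ⟨g, hg⟩ := this
  rw [← hg]
  congr 1
  ext u
  rw [← hh u]
  change _ = algebraMapInv (ct u (ct v w))
  rw [← hg, ct_ι]
  exact (algebraMap_leftInverse (R := ℝ) (Module.Dual ℝ V) (g u)).symm

lemma ct_ιMulti (v : V) (m : ℕ) : ∀ u : Fin (m + 1) → Module.Dual ℝ V,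
    ct v (ιMulti ℝ (m + 1) u) =
      ∑ j : Fin (m + 1), ((-1 : ℝ) ^ (j : ℕ) * u j v) • ιMulti ℝ m (fun i => u (j.succAbove i)) := by
  induction m with
  | zero =>
    intro u
    simp [ct_ι, Algebra.smul_def]
  | succ m ih =>
    intro u
    rw [ιMulti_succ_apply, ct_ι_mul, ih, Fin.sum_univ_succ (n := m + 1), Finset.mul_sum, sub_eq_add_neg,
      ← Finset.sum_neg_distrib]
    congr 1
    · simp [Matrix.vecTail, Function.comp_def]
    · refine Finset.sum_congr rfl fun j _ => ?_
      rw [ιMulti_succ_apply (n := m)]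
      simp only [Matrix.vecTail, Function.comp_def, Fin.succ_succAbove_zero,
        Fin.succ_succAbove_succ, Fin.val_succ, pow_succ, mul_neg, mul_one, neg_mul, neg_smul,
        mul_smul_comm]

end general

section metric

variable {V : Type*} [NormedAddCommGroup V] [InnerProductSpace ℝ V] [FiniteDimensional ℝ V]

lemma finite_ext : Module.Finite ℝ (ExteriorAlgebra ℝ (Module.Dual ℝ V)) := by
  classical
  exact Module.Finite.of_basis (Module.finBasis ℝ (Module.Dual ℝ V)).ExteriorAlgebra

lemma inner_sharp (f : Module.Dual ℝ V) (w : V) : inner (𝕜 := ℝ) (sharp f) w = f w := by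
  simp [sharp]

lemma gd_eq (f g : Module.Dual ℝ V) : gd f g = g (sharp f) := by
  rw [gd, real_inner_comm, inner_sharp]

lemma gd_symm (f g : Module.Dual ℝ V) : gd f g = gd g f := by
  rw [gd, real_inner_comm, gd]

lemma sharp_flat (v : V) : sharp (innerₗ V v) = v := by
  refine ext_inner_right ℝ fun w => ?_
  rw [inner_sharp, innerₗ_apply_apply]

lemma bilin_ext
    (C D : ExteriorAlgebra ℝ (Module.Dual ℝ V) →ₗ[ℝ] ExteriorAlgebra ℝ (Module.Dual ℝ V) →ₗ[ℝ] ℝ)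
    (h : ∀ (p q : ℕ) (u : Fin p → Module.Dual ℝ V) (v : Fin q → Module.Dual ℝ V),
      C (ιMulti ℝ p u) (ιMulti ℝ q v) = D (ιMulti ℝ p u) (ιMulti ℝ q v)) : C = D := by
  refine LinearMap.ext_on (ιMulti_span ℝ (Module.Dual ℝ V)) ?_
  rintro _ ⟨⟨p, u⟩, rfl⟩
  refine LinearMap.ext_on (ιMulti_span ℝ (Module.Dual ℝ V)) ?_
  rintro _ ⟨⟨q, v⟩, rfl⟩
  exact h p q u v

lemma ιMulti_mem (p : ℕ) (u : Fin p → Module.Dual ℝ V) :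
    ιMulti ℝ p u ∈ ⋀[ℝ]^p (Module.Dual ℝ V) :=
  ιMulti_range ℝ p ⟨u, rfl⟩

variable
    {B : ExteriorAlgebra ℝ (Module.Dual ℝ V) →ₗ[ℝ] ExteriorAlgebra ℝ (Module.Dual ℝ V) →ₗ[ℝ] ℝ}

lemma B_symm (hB : IsInducedInner B) (x y : ExteriorAlgebra ℝ (Module.Dual ℝ V)) :
    B x y = B y x := by
  have : B = B.flip := by
    refine bilin_ext _ _ ?_
    intro p q u v
    rw [LinearMap.flip_apply]
    by_cases hpq : p = q
    · subst hpq
      rw [hB.1, hB.1, ← Matrix.det_transpose]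
      congr 1
      ext i j
      simp [gd_symm]
    · rw [hB.2 p q hpq _ (ιMulti_mem p u) _ (ιMulti_mem q v),
        hB.2 q p (Ne.symm hpq) _ (ιMulti_mem q v) _ (ιMulti_mem p u)]
  exact congrArg (fun C => C x y) this

lemma B_adj (hB : IsInducedInner B) (f : Module.Dual ℝ V)
    (x y : ExteriorAlgebra ℝ (Module.Dual ℝ V)) :
    B (ι ℝ f * x) y = B x (ct (sharp f) y) := by
  have : B ∘ₗ (LinearMap.mulLeft ℝ (ι ℝ f)) = B.compl₂ (ct (sharp f)) := by
    refine bilin_ext _ _ ?_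
    intro p q u v
    change B (ι ℝ f * ιMulti ℝ p u) (ιMulti ℝ q v) =
      B (ιMulti ℝ p u) (ct (sharp f) (ιMulti ℝ q v))
    by_cases hpq : q = p + 1
    · subst hpq
      have h1 : ι ℝ f * ιMulti ℝ p u = ιMulti ℝ (p + 1) (Matrix.vecCons f u) := by
        rw [ιMulti_succ_apply]; simp
      rw [h1, hB.1, ct_ιMulti, map_sum, Matrix.det_succ_row_zero]
      refine Finset.sum_congr rfl fun j _ => ?_
      rw [map_smul, hB.1, smul_eq_mul]
      simp only [Matrix.of_apply, Matrix.cons_val_zero, gd_eq]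
      congr 1
    · rw [hB.2 (p + 1) q (Ne.symm hpq) _ (ι_mul_mem p f _ (ιMulti_mem p u)) _ (ιMulti_mem q v)]
      rcases q with _ | q
      · rw [ct_zero_form _ _ (ιMulti_mem 0 v), map_zero]
      · rw [hB.2 p q (by omega) _ (ιMulti_mem p u) _ (ct_mem _ _ _ (ιMulti_mem _ v))]
  exact congrArg (fun C => C x y) this

lemma B_adj' (hB : IsInducedInner B) (v : V)
    (x y : ExteriorAlgebra ℝ (Module.Dual ℝ V)) :
    B x (ι ℝ (innerₗ V v) * y) = B (ct v x) y := by
  rw [B_symm hB, B_adj hB, sharp_flat, B_symm hB]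

lemma onb_resolution {I : Type*} [Fintype I] (b : OrthonormalBasis I ℝ V) (h : Module.Dual ℝ V) :
    ∑ i, h (b i) • innerₗ V (b i) = h := by
  ext w
  conv_rhs => rw [← b.sum_repr' w]
  simp [mul_comm]

lemma onb_resolution_J {I : Type*} [Fintype I] (b : OrthonormalBasis I ℝ V)
    (J : V →ₗ[ℝ] V) (hJ2 : J ∘ₗ J = -LinearMap.id)
    (hJg : ∀ u v : V, inner (𝕜 := ℝ) (J u) (J v) = inner (𝕜 := ℝ) u v) (h : Module.Dual ℝ V) :
    ∑ i, h (J (b i)) • innerₗ V (J (b i)) = h := by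
  have hJJ : ∀ w, J (J w) = - w := fun w => congrArg (fun C => C w) hJ2
  ext w
  have h1 : h w = - (h ∘ₗ J) (J w) := by simp [hJJ]
  have h2 : ∀ i, inner ℝ (J (b i)) w = - inner ℝ (b i) (J w) := by
    intro i
    rw [← hJg, hJJ, inner_neg_left]
  rw [h1]
  conv_rhs => rw [← b.sum_repr' (J w)]
  simp [h2, mul_comm]

lemma B_def (hB : IsInducedInner B) (k : ℕ) : ∀ x : ExteriorAlgebra ℝ (Module.Dual ℝ V),
    x ∈ ⋀[ℝ]^k (Module.Dual ℝ V) → 0 ≤ B x x ∧ (B x x = 0 → x = 0) := by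
  induction k with
  | zero =>
    intro x hx
    rw [exteriorPower, pow_zero, Submodule.mem_one] at hx
    obtain ⟨r, rfl⟩ := hx
    have h1 : B 1 1 = 1 := by
      have := hB.1 0 ![] ![]
      simpa using this
    rw [Algebra.algebraMap_eq_smul_one]
    simp only [map_smul, LinearMap.smul_apply, h1, smul_eq_mul, mul_one]
    refine ⟨mul_self_nonneg r, fun h => ?_⟩
    rw [mul_self_eq_zero.1 h, zero_smul]
  | succ k ih =>
    intro x hx
    let b := stdOrthonormalBasis ℝ V
    have h0 := degree_op (fun i => innerₗ V (b i)) b (onb_resolution b) (k + 1) x hx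
    have h1 : ((k + 1 : ℕ) : ℝ) * B x x = ∑ i, B (ct (b i) x) (ct (b i) x) := by
      rw [← smul_eq_mul, ← LinearMap.smul_apply, ← map_smul, ← h0, map_sum, LinearMap.sum_apply]
      refine Finset.sum_congr rfl fun i _ => ?_
      rw [B_adj hB, sharp_flat]
    have hk : (0 : ℝ) < ((k + 1 : ℕ) : ℝ) := by positivity
    have hn : ∀ i ∈ Finset.univ, 0 ≤ B (ct (b i) x) (ct (b i) x) :=
      fun i _ => (ih _ (ct_mem _ _ _ hx)).1
    constructor
    · have := Finset.sum_nonneg hn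
      rw [← h1] at this
      exact nonneg_of_mul_nonneg_right this hk
    · intro hz
      rw [hz, mul_zero] at h1
      have h2 := (Finset.sum_eq_zero_iff_of_nonneg hn).1 h1.symm
      have h3 : ∀ i, ct (b i) x = 0 := fun i =>
        (ih _ (ct_mem _ _ _ hx)).2 (h2 i (Finset.mem_univ i))
      simp only [h3, mul_zero, Finset.sum_const_zero] at h0
      exact (smul_eq_zero.1 h0.symm).resolve_left hk.ne'

lemma B_nondeg (hB : IsInducedInner B) (z : ExteriorAlgebra ℝ (Module.Dual ℝ V))
    (hz : ∀ (m : ℕ), ∀ y ∈ ⋀[ℝ]^m (Module.Dual ℝ V), B z y = 0) : z = 0 := by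
  classical
  let A : ℕ → Submodule ℝ (ExteriorAlgebra ℝ (Module.Dual ℝ V)) :=
    fun i => ⋀[ℝ]^i (Module.Dual ℝ V)
  have hs := DirectSum.sum_support_decompose A z
  have h0 : ∀ m, (DirectSum.decompose A z m : ExteriorAlgebra ℝ (Module.Dual ℝ V)) = 0 := by
    intro m
    refine (B_def hB m _ (DirectSum.decompose A z m).2).2 ?_
    have h1 := hz m _ (DirectSum.decompose A z m).2
    rw [← hs, map_sum, LinearMap.sum_apply] at h1
    rw [hs] at h1
    rw [Finset.sum_eq_single m] at h1
    · exact h1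
    · intro j _ hj
      exact hB.2 j m hj _ (DirectSum.decompose A z j).2 _ (DirectSum.decompose A z m).2
    · intro hm
      rw [DFinsupp.notMem_support_iff.1 hm]
      simp
  rw [← hs]
  exact Finset.sum_eq_zero fun m _ => h0 m

end metric

section lefschetz

variable {V : Type*} [NormedAddCommGroup V] [InnerProductSpace ℝ V] [FiniteDimensional ℝ V]
    {B : ExteriorAlgebra ℝ (Module.Dual ℝ V) →ₗ[ℝ] ExteriorAlgebra ℝ (Module.Dual ℝ V) →ₗ[ℝ] ℝ}
    {Lam : ExteriorAlgebra ℝ (Module.Dual ℝ V) →ₗ[ℝ] ExteriorAlgebra ℝ (Module.Dual ℝ V)}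
    {J : V →ₗ[ℝ] V} {ω : ExteriorAlgebra ℝ (Module.Dual ℝ V)}

lemma ct_omega (hω2 : ω ∈ ⋀[ℝ]^2 (Module.Dual ℝ V))
    (hωJ : ∀ u v : V, formEval ω u v = inner (𝕜 := ℝ) (J u) v) (v : V) :
    ct v ω = ι ℝ (innerₗ V (J v)) :=
  ct_two v ω hω2 _ fun u => by rw [hωJ, innerₗ_apply_apply]

lemma Lam_eq (hω2 : ω ∈ ⋀[ℝ]^2 (Module.Dual ℝ V))
    (hωJ : ∀ u v : V, formEval ω u v = inner (𝕜 := ℝ) (J u) v)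
    (hB : IsInducedInner B)
    (hLam : ∀ x y : ExteriorAlgebra ℝ (Module.Dual ℝ V), B (Lam x) y = B x (ω * y))
    {I : Type*} [Fintype I] (b : OrthonormalBasis I ℝ V)
    (x : ExteriorAlgebra ℝ (Module.Dual ℝ V)) :
    (2 : ℝ) • Lam x = ∑ i, ct (J (b i)) (ct (b i) x) := by
  rw [← sub_eq_zero]
  refine B_nondeg hB _ fun m y _ => ?_
  have h0 := degree_op (fun i => innerₗ V (b i)) b (onb_resolution b) 2 ω hω2
  simp only [ct_omega hω2 hωJ, Nat.cast_ofNat] at h0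
  have h1 : (2 : ℝ) * B (Lam x) y = ∑ i, B (ct (J (b i)) (ct (b i) x)) y := by
    rw [hLam, ← smul_eq_mul, ← map_smul, ← smul_mul_assoc, ← h0, Finset.sum_mul, map_sum]
    refine Finset.sum_congr rfl fun i _ => ?_
    rw [mul_assoc, B_adj' hB, B_adj' hB]
  rw [map_sub, map_smul, LinearMap.sub_apply, LinearMap.smul_apply, smul_eq_mul, h1, map_sum,
    LinearMap.sum_apply, sub_self]

lemma lefschetz_comm {n : ℕ} (hdim : Module.finrank ℝ V = 2 * n)
    (hJ2 : J ∘ₗ J = -LinearMap.id)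
    (hJg : ∀ u v : V, inner (𝕜 := ℝ) (J u) (J v) = inner (𝕜 := ℝ) u v)
    (hω2 : ω ∈ ⋀[ℝ]^2 (Module.Dual ℝ V))
    (hωJ : ∀ u v : V, formEval ω u v = inner (𝕜 := ℝ) (J u) v)
    (hB : IsInducedInner B)
    (hLam : ∀ x y : ExteriorAlgebra ℝ (Module.Dual ℝ V), B (Lam x) y = B x (ω * y))
    (k : ℕ) (x : ExteriorAlgebra ℝ (Module.Dual ℝ V)) (hx : x ∈ ⋀[ℝ]^k (Module.Dual ℝ V)) :
    Lam (ω * x) = ω * Lam x + ((n : ℝ) - k) • x := by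
  have hJJ : ∀ w, J (J w) = - w := fun w => congrArg (fun C => C w) hJ2
  let b := stdOrthonormalBasis ℝ V
  have hdR : (Module.finrank ℝ V : ℝ) = 2 * n := by rw [hdim]; push_cast; rfl
  have hL := Lam_eq hω2 hωJ hB hLam b
  have d1 := degree_op (fun i => innerₗ V (b i)) b (onb_resolution b) k x hx
  have d2 := degree_op (fun i => innerₗ V (J (b i))) (fun i => J (b i))
    (onb_resolution_J b J hJ2 hJg) k x hx
  have key : (2 : ℝ) • Lam (ω * x) = (2 : ℝ) • (ω * Lam x + ((n : ℝ) - k) • x) := by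
    rw [smul_add, ← mul_smul_comm, hL, hL]
    have h1 : ∀ i, ct (J (b i)) (ct (b i) (ω * x)) =
        ω * ct (J (b i)) (ct (b i) x) + x - ι ℝ (innerₗ V (b i)) * ct (b i) x
          - ι ℝ (innerₗ V (J (b i))) * ct (J (b i)) x := by
      intro i
      rw [ct_two_mul _ _ _ hω2, ct_omega hω2 hωJ, map_add, ct_two_mul _ _ _ hω2,
        ct_omega hω2 hωJ, hJJ, ct_ι_mul, innerₗ_apply_apply, hJg, map_neg, map_neg, neg_mul,
        real_inner_self_eq_norm_sq, b.norm_eq_one]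
      simp only [one_pow, one_smul]
      abel
    rw [Finset.sum_congr rfl (fun i _ => h1 i), Finset.sum_sub_distrib, Finset.sum_sub_distrib,
      Finset.sum_add_distrib, d1, d2, ← Finset.mul_sum, Finset.sum_const, Finset.card_univ,
      Fintype.card_fin, ← Nat.cast_smul_eq_nsmul ℝ, hdR]
    module
  exact smul_right_injective _ (two_ne_zero' ℝ) key

lemma omega_pow_mem (hω2 : ω ∈ ⋀[ℝ]^2 (Module.Dual ℝ V)) (k i : ℕ)
    (x : ExteriorAlgebra ℝ (Module.Dual ℝ V)) (hx : x ∈ ⋀[ℝ]^k (Module.Dual ℝ V)) :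
    ω ^ i * x ∈ ⋀[ℝ]^(2 * i + k) (Module.Dual ℝ V) := by
  rw [exteriorPower, pow_add, pow_mul]
  exact Submodule.mul_mem_mul (Submodule.pow_mem_pow _ hω2 i) hx

lemma omega_mul_mem (hω2 : ω ∈ ⋀[ℝ]^2 (Module.Dual ℝ V)) (k : ℕ)
    (x : ExteriorAlgebra ℝ (Module.Dual ℝ V)) (hx : x ∈ ⋀[ℝ]^k (Module.Dual ℝ V)) :
    ω * x ∈ ⋀[ℝ]^(k + 2) (Module.Dual ℝ V) := by
  have := omega_pow_mem hω2 k 1 x hx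
  rwa [pow_one, mul_one, add_comm] at this

lemma Lam_pow {n : ℕ} (hω2 : ω ∈ ⋀[ℝ]^2 (Module.Dual ℝ V))
    (hcomm : ∀ (k : ℕ) (x : ExteriorAlgebra ℝ (Module.Dual ℝ V)),
      x ∈ ⋀[ℝ]^k (Module.Dual ℝ V) → Lam (ω * x) = ω * Lam x + ((n : ℝ) - k) • x)
    (m : ℕ) (a : ExteriorAlgebra ℝ (Module.Dual ℝ V)) (ha : a ∈ ⋀[ℝ]^m (Module.Dual ℝ V))
    (h0 : Lam a = 0) (i : ℕ) : ∃ c : ℝ, Lam (ω ^ (i + 1) * a) = c • (ω ^ i * a) := by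
  induction i with
  | zero => exact ⟨(n : ℝ) - m, by rw [zero_add, pow_one, hcomm m a ha, h0]; simp⟩
  | succ i ih =>
    obtain ⟨c, hc⟩ := ih
    refine ⟨c + ((n : ℝ) - (2 * (i + 1) + m : ℕ)), ?_⟩
    rw [pow_succ' ω (i + 1), mul_assoc, hcomm _ _ (omega_pow_mem hω2 m (i + 1) a ha), hc,
      mul_smul_comm, ← mul_assoc, ← pow_succ', add_smul]

lemma orth_lt {n : ℕ} (hω2 : ω ∈ ⋀[ℝ]^2 (Module.Dual ℝ V))
    (hLam : ∀ x y : ExteriorAlgebra ℝ (Module.Dual ℝ V), B (Lam x) y = B x (ω * y))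
    (hcomm : ∀ (k : ℕ) (x : ExteriorAlgebra ℝ (Module.Dual ℝ V)),
      x ∈ ⋀[ℝ]^k (Module.Dual ℝ V) → Lam (ω * x) = ω * Lam x + ((n : ℝ) - k) • x)
    (m : ℕ) (a b : ExteriorAlgebra ℝ (Module.Dual ℝ V)) (ha : a ∈ ⋀[ℝ]^m (Module.Dual ℝ V))
    (h0 : Lam a = 0) (i : ℕ) : ∀ j, B (ω ^ i * a) (ω ^ (i + j + 1) * b) = 0 := by
  induction i with
  | zero =>
    intro j
    rw [pow_zero, one_mul, pow_succ', mul_assoc, ← hLam, h0, map_zero, LinearMap.zero_apply]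
  | succ i ih =>
    intro j
    obtain ⟨c, hc⟩ := Lam_pow hω2 hcomm m a ha h0 i
    rw [pow_succ' ω (i + 1 + j), mul_assoc, ← hLam, hc, map_smul, LinearMap.smul_apply,
      show i + 1 + j = i + j + 1 by omega, ih, smul_zero]

/-- The summands of the Lefschetz decomposition. -/
def summand (ω : ExteriorAlgebra ℝ (Module.Dual ℝ V))
    (Lam : ExteriorAlgebra ℝ (Module.Dual ℝ V) →ₗ[ℝ] ExteriorAlgebra ℝ (Module.Dual ℝ V))
    (k i : ℕ) : Submodule ℝ (ExteriorAlgebra ℝ (Module.Dual ℝ V)) :=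
  if 2 * i ≤ k then
    Submodule.map ((LinearMap.mulLeft ℝ ω) ^ i)
      (⋀[ℝ]^(k - 2 * i) (Module.Dual ℝ V) ⊓ LinearMap.ker Lam)
  else ⊥

lemma mem_summand (k i : ℕ) (x : ExteriorAlgebra ℝ (Module.Dual ℝ V)) (hx : x ∈ summand ω Lam k i) :
    ∃ a ∈ ⋀[ℝ]^(k - 2 * i) (Module.Dual ℝ V), Lam a = 0 ∧ x = ω ^ i * a ∧
      (2 * i ≤ k ∨ x = 0) := by
  unfold summand at hx
  split_ifs at hx with h
  · obtain ⟨a, ⟨ha, h0⟩, rfl⟩ := hx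
    refine ⟨a, ha, h0, ?_, Or.inl h⟩
    rw [LinearMap.pow_mulLeft, LinearMap.mulLeft_apply]
  · rw [Submodule.mem_bot] at hx
    subst hx
    exact ⟨0, Submodule.zero_mem _, map_zero _, by simp, Or.inr rfl⟩

lemma summand_le (hω2 : ω ∈ ⋀[ℝ]^2 (Module.Dual ℝ V)) (k i : ℕ) :
    summand ω Lam k i ≤ ⋀[ℝ]^k (Module.Dual ℝ V) := by
  intro x hx
  obtain ⟨a, ha, -, h1, h2 | h2⟩ := mem_summand k i x hx
  · rw [h1]
    have := omega_pow_mem hω2 _ i a ha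
    rwa [show 2 * i + (k - 2 * i) = k by omega] at this
  · rw [h2]; exact Submodule.zero_mem _

lemma map_summand (k i : ℕ) :
    Submodule.map (LinearMap.mulLeft ℝ ω) (summand ω Lam k i) ≤ summand ω Lam (k + 2) (i + 1) := by
  unfold summand
  by_cases h : 2 * i ≤ k
  · rw [if_pos h, if_pos (by omega), show k + 2 - 2 * (i + 1) = k - 2 * i by omega,
      ← Submodule.map_comp, pow_succ']
    exact le_rfl
  · rw [if_neg h, Submodule.map_bot]; exact bot_le

lemma orth_compl_mem (hB : IsInducedInner B) (k : ℕ)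
    (U : Submodule ℝ (ExteriorAlgebra ℝ (Module.Dual ℝ V)))
    (hU : U ≤ ⋀[ℝ]^k (Module.Dual ℝ V)) (x : ExteriorAlgebra ℝ (Module.Dual ℝ V)) :
    ∃ u ∈ U, ∀ y ∈ U, B (x - u) y = 0 := by
  haveI := finite_ext (V := V)
  have hr : LinearMap.BilinForm.IsRefl (B : LinearMap.BilinForm ℝ _) := fun a b h => by
    rw [B_symm hB]; exact h
  have hc := (LinearMap.BilinForm.isCompl_orthogonal_iff_disjoint (W := U) hr).2 (by
    rw [Submodule.disjoint_def]
    intro z hz hz'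
    exact (B_def hB k z (hU hz)).2 (hz' z hz))
  have hx : x ∈ U ⊔ LinearMap.BilinForm.orthogonal B U := by rw [hc.sup_eq_top]; trivial
  obtain ⟨u, hu, z, hz, rfl⟩ := Submodule.mem_sup.1 hx
  refine ⟨u, hu, fun y hy => ?_⟩
  rw [add_sub_cancel_left, B_symm hB]
  exact hz y hy

lemma le_iSup_summand (hω2 : ω ∈ ⋀[ℝ]^2 (Module.Dual ℝ V))
    (hB : IsInducedInner B)
    (hLam : ∀ x y : ExteriorAlgebra ℝ (Module.Dual ℝ V), B (Lam x) y = B x (ω * y)) (k : ℕ) :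
    ⋀[ℝ]^k (Module.Dual ℝ V) ≤ ⨆ i, summand ω Lam k i := by
  induction k using Nat.strong_induction_on with
  | _ k ih =>
  intro x hx
  -- primitive forms lie in the zeroth summand
  have hprim : ∀ z ∈ ⋀[ℝ]^k (Module.Dual ℝ V),
      (∀ m, m + 2 = k → ∀ y ∈ ⋀[ℝ]^m (Module.Dual ℝ V), B z (ω * y) = 0) →
      z ∈ summand ω Lam k 0 := by
    intro z hz hzy
    have h0 : Lam z = 0 := by
      refine B_nondeg hB _ fun m y hy => ?_
      rw [hLam]
      by_cases hm : m + 2 = k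
      · exact hzy m hm y hy
      · exact hB.2 k (m + 2) (Ne.symm hm) _ hz _ (omega_mul_mem hω2 m y hy)
    unfold summand
    rw [if_pos (by omega)]
    exact ⟨z, ⟨hz, h0⟩, by simp⟩
  by_cases hk : k < 2
  · exact Submodule.mem_iSup_of_mem 0 (hprim x hx fun m hm => by omega)
  · obtain ⟨l, rfl⟩ : ∃ l, k = l + 2 := ⟨k - 2, by omega⟩
    have hU : Submodule.map (LinearMap.mulLeft ℝ ω) (⋀[ℝ]^l (Module.Dual ℝ V)) ≤
        ⋀[ℝ]^(l + 2) (Module.Dual ℝ V) := by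
      rintro _ ⟨y, hy, rfl⟩
      exact omega_mul_mem hω2 l y hy
    obtain ⟨u, hu, hux⟩ := orth_compl_mem hB (l + 2) _ hU x
    have h1 : x - u ∈ summand ω Lam (l + 2) 0 := by
      refine hprim _ (Submodule.sub_mem _ hx (hU hu)) fun m hm y hy => ?_
      obtain rfl : m = l := by omega
      exact hux _ ⟨y, hy, rfl⟩
    have h2 : u ∈ ⨆ i, summand ω Lam (l + 2) i := by
      have h3 := Submodule.map_mono (f := LinearMap.mulLeft ℝ ω) (ih l (by omega)) hu
      rw [Submodule.map_iSup] at h3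
      refine SetLike.le_def.1 (iSup_le fun i => ?_) h3
      exact (map_summand l i).trans (le_iSup (fun i => summand ω Lam (l + 2) i) (i + 1))
    rw [← sub_add_cancel x u]
    exact Submodule.add_mem _ (Submodule.mem_iSup_of_mem 0 h1) h2

lemma summand_orth {n : ℕ} (hω2 : ω ∈ ⋀[ℝ]^2 (Module.Dual ℝ V)) (hB : IsInducedInner B)
    (hLam : ∀ x y : ExteriorAlgebra ℝ (Module.Dual ℝ V), B (Lam x) y = B x (ω * y))
    (hcomm : ∀ (k : ℕ) (x : ExteriorAlgebra ℝ (Module.Dual ℝ V)),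
      x ∈ ⋀[ℝ]^k (Module.Dual ℝ V) → Lam (ω * x) = ω * Lam x + ((n : ℝ) - k) • x)
    (k i j : ℕ) (hij : i ≠ j) (x y : ExteriorAlgebra ℝ (Module.Dual ℝ V))
    (hx : x ∈ summand ω Lam k i) (hy : y ∈ summand ω Lam k j) : B x y = 0 := by
  obtain ⟨a, ha, ha0, rfl, -⟩ := mem_summand k i x hx
  obtain ⟨b, hb, hb0, rfl, -⟩ := mem_summand k j y hy
  rcases lt_or_gt_of_ne hij with h | h
  · obtain ⟨l, rfl⟩ := Nat.exists_eq_add_of_lt h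
    exact orth_lt hω2 hLam hcomm _ a b ha ha0 i l
  · obtain ⟨l, rfl⟩ := Nat.exists_eq_add_of_lt h
    rw [B_symm hB]
    exact orth_lt hω2 hLam hcomm _ b a hb hb0 j l

end lefschetz

theorem stmt14
    {V : Type*} [NormedAddCommGroup V] [InnerProductSpace ℝ V] [FiniteDimensional ℝ V]
    (n : ℕ) (hdim : Module.finrank ℝ V = 2 * n)
    (J : V →ₗ[ℝ] V) (hJ2 : J ∘ₗ J = -LinearMap.id)
    (hJg : ∀ u v : V, inner (𝕜 := ℝ) (J u) (J v) = inner (𝕜 := ℝ) u v)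
    (ω : ExteriorAlgebra ℝ (Module.Dual ℝ V))
    (hω2 : ω ∈ ⋀[ℝ]^2 (Module.Dual ℝ V))
    (hωJ : ∀ u v : V, formEval ω u v = inner (𝕜 := ℝ) (J u) v)
    (B : ExteriorAlgebra ℝ (Module.Dual ℝ V) →ₗ[ℝ] ExteriorAlgebra ℝ (Module.Dual ℝ V) →ₗ[ℝ] ℝ)
    (hB : IsInducedInner B)
    (Lam : ExteriorAlgebra ℝ (Module.Dual ℝ V) →ₗ[ℝ] ExteriorAlgebra ℝ (Module.Dual ℝ V))
    (hLam : ∀ x y : ExteriorAlgebra ℝ (Module.Dual ℝ V), B (Lam x) y = B x (ω * y))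
    (k : ℕ)
    (Q : ℕ → Submodule ℝ (ExteriorAlgebra ℝ (Module.Dual ℝ V)))
    (hQ : ∀ i : ℕ, Q i =
      if 2 * i ≤ k then
        Submodule.map ((LinearMap.mulLeft ℝ ω) ^ i)
          (⋀[ℝ]^(k - 2 * i) (Module.Dual ℝ V) ⊓ LinearMap.ker Lam)
      else ⊥) :
    iSupIndep Q ∧ (⨆ i, Q i) = ⋀[ℝ]^k (Module.Dual ℝ V) := by
  have hcomm := lefschetz_comm hdim hJ2 hJg hω2 hωJ hB hLam
  obtain rfl : Q = summand ω Lam k := funext hQ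
  refine ⟨?_, le_antisymm (iSup_le fun i => summand_le hω2 k i)
    (le_iSup_summand hω2 hB hLam k)⟩
  intro i
  rw [Submodule.disjoint_def]
  intro x hx hx'
  refine (B_def hB k x (summand_le hω2 k i hx)).2 ?_
  have h : (⨆ j, ⨆ (_ : j ≠ i), summand ω Lam k j) ≤ LinearMap.ker (B x) := by
    refine iSup_le fun j => iSup_le fun hj => fun y hy => ?_
    exact summand_orth hω2 hB hLam hcomm k i j (Ne.symm hj) x y hx hy
  exact h hx'
end
end
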